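/- arXiv:2508.05392 — 2 statements merged into one kernel-verified Lean document; each statement's English description precedes it below -/
import Mathlib

section
/- Let 1 < p < ∞. There exists a constant C_p > 0 depending only on p (independent of the dimension d) such that for every d ≥ 1 and every f ∈ ℓ_p(ℤ^d; ℂ), ‖ sup_{t > 0} |e^{−tL} f| ‖_{ℓ_p(ℤ^d)} ≤ C_p ‖f‖_{ℓ_p(ℤ^d)}, where the pointwise supremum over t > 0 is taken at each x ∈ ℤ^d. (Scalar-valued case of Proposition 3.1, the dimension-free maximal inequality for the discrete heat-type semigroup.) -/
open MeasureTheory ENNReal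

/-- The `k`-th standard basis vector of `ℤ^d`. -/
def stdBasisZ (d : ℕ) (k : Fin d) : Fin d → ℤ := fun j => if j = k then 1 else 0

/-- The discrete Laplacian-type operator
`L f (x) = ∑_{k=1}^d ((1/2) f(x) − (1/4)(f(x + e_k) + f(x − e_k)))`. -/
noncomputable def Lop (d : ℕ) (f : (Fin d → ℤ) → ℂ) : (Fin d → ℤ) → ℂ :=
  fun x => ∑ k : Fin d,
    ((1 / 2 : ℂ) * f x - (1 / 4 : ℂ) * (f (x + stdBasisZ d k) + f (x - stdBasisZ d k)))

/-- The heat-type semigroup `e^{-tL} f = ∑_{n≥0} (-t)^n / n! · L^n f`. -/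
noncomputable def heatSemigroup (d : ℕ) (t : ℝ) (f : (Fin d → ℤ) → ℂ)
    (x : Fin d → ℤ) : ℂ :=
  ∑' n : ℕ, ((-t : ℂ) ^ n / (Nat.factorial n : ℂ)) * ((Lop d)^[n] f x)

/-- The `ℓ_p` norm on `ℤ^d` of an `ℝ≥0∞`-valued function. -/
noncomputable def lpNorm (d : ℕ) (p : ℝ) (g : (Fin d → ℤ) → ℝ≥0∞) : ℝ≥0∞ :=
  (∑' x : Fin d → ℤ, (g x) ^ p) ^ (1 / p)

open Filter Topology

/-- The averaging operator `F ↦ ∑ i, a i * F ∘ e i`. -/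
noncomputable def averageOp {X ι : Type*} [Fintype ι] (a : ι → ℝ≥0∞) (e : ι → X ≃ X)
    (F : X → ℝ≥0∞) : X → ℝ≥0∞ :=
  fun x => ∑ i, a i * F (e i x)

section AverageOp

variable {X ι : Type*} [Fintype ι] {a : ι → ℝ≥0∞} {e : ι → X ≃ X}

lemma averageOp_mono : Monotone (averageOp a e) := fun F G h x =>
  Finset.sum_le_sum fun i _ => by gcongr; exact h _

lemma averageOp_add (F G : X → ℝ≥0∞) :
    averageOp a e (F + G) = averageOp a e F + averageOp a e G := by
  funext x
  simp [averageOp, mul_add, Finset.sum_add_distrib]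

lemma averageOp_iterate_add (n : ℕ) (F G : X → ℝ≥0∞) :
    (averageOp a e)^[n] (F + G) = (averageOp a e)^[n] F + (averageOp a e)^[n] G := by
  induction n generalizing F G with
  | zero => rfl
  | succ n ih => simp only [Function.iterate_succ_apply, averageOp_add, ih]

lemma averageOp_const (ha : ∑ i, a i = 1) (c : ℝ≥0∞) :
    averageOp a e (fun _ => c) = fun _ => c := by
  funext x
  simp [averageOp, ← Finset.sum_mul, ha]

lemma averageOp_iterate_const (ha : ∑ i, a i = 1) (n : ℕ) (c : ℝ≥0∞) :
    (averageOp a e)^[n] (fun _ => c) = fun _ => c :=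
  Function.iterate_fixed (averageOp_const ha c) n

/-- Weighted Jensen inequality: convexity of `(h, v) ↦ h ^ p * v ^ (1 - p)`. -/
lemma averageOp_rpow_le {p : ℝ} (hp : 1 < p) (h v : X → ℝ≥0∞) (hv0 : ∀ x, v x ≠ 0)
    (hv : ∀ x, v x ≠ ∞) (x : X) (hQ0 : averageOp a e v x ≠ 0) (hQ : averageOp a e v x ≠ ∞) :
    averageOp a e h x ^ p * averageOp a e v x ^ (1 - p) ≤
      averageOp a e (fun y => h y ^ p * v y ^ (1 - p)) x := by
  have hp0 : 0 < p := by linarith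
  have key := ENNReal.inner_le_weight_mul_Lp_of_nonneg Finset.univ hp.le
    (fun i => a i * v (e i x)) (fun i => h (e i x) / v (e i x))
  have h1 : ∀ i, a i * v (e i x) * (h (e i x) / v (e i x)) = a i * h (e i x) := fun i => by
    rw [mul_assoc, ENNReal.mul_div_cancel (hv0 _) (hv _)]
  have h2 : ∀ i, a i * v (e i x) * (h (e i x) / v (e i x)) ^ p =
      a i * (h (e i x) ^ p * v (e i x) ^ (1 - p)) := fun i => by
    rw [ENNReal.div_rpow_of_nonneg _ _ hp0.le, ENNReal.rpow_sub _ _ (hv0 _) (hv _),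
      ENNReal.rpow_one]
    simp only [div_eq_mul_inv]
    ring
  simp only [h1, h2] at key
  have key' := ENNReal.rpow_le_rpow key hp0.le
  rw [ENNReal.mul_rpow_of_nonneg _ _ hp0.le, ← ENNReal.rpow_mul, ← ENNReal.rpow_mul,
    inv_mul_cancel₀ hp0.ne', ENNReal.rpow_one,
    show (1 - p⁻¹) * p = -(1 - p) by field_simp; ring, ENNReal.rpow_neg] at key'
  have hR0 : averageOp a e v x ^ (1 - p) ≠ 0 := by
    simp [ENNReal.rpow_eq_zero_iff, hQ0, hQ]
  have hR : averageOp a e v x ^ (1 - p) ≠ ∞ := by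
    simp [ENNReal.rpow_eq_top_iff, hQ0, hQ]
  calc averageOp a e h x ^ p * averageOp a e v x ^ (1 - p)
      ≤ ((averageOp a e v x ^ (1 - p))⁻¹ *
          averageOp a e (fun y => h y ^ p * v y ^ (1 - p)) x) *
            averageOp a e v x ^ (1 - p) := by
        gcongr
        exact key'
    _ = _ := by
        rw [mul_right_comm, ENNReal.inv_mul_cancel hR0 hR, one_mul]

lemma averageOp_iterate_rpow_le {p : ℝ} (hp : 1 < p) (ha : ∑ i, a i = 1) (n : ℕ)
    (h : X → ℝ≥0∞) (x : X) :
    (averageOp a e)^[n] h x ^ p ≤ (averageOp a e)^[n] (fun y => h y ^ p) x := by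
  induction n generalizing h x with
  | zero => rfl
  | succ n ih =>
    simp only [Function.iterate_succ_apply]
    refine (ih _ x).trans (averageOp_mono.iterate n (fun y => ?_) x)
    simpa [averageOp_const ha] using averageOp_rpow_le (a := a) (e := e) hp h (fun _ => 1)
      (by simp) (by simp) y (by simp [averageOp_const ha]) (by simp [averageOp_const ha])

lemma tsum_averageOp_mul {σ : ι ≃ ι} (haσ : ∀ i, a (σ i) = a i)
    (heσ : ∀ i, e (σ i) = (e i).symm) (F G : X → ℝ≥0∞) :
    ∑' x, averageOp a e F x * G x = ∑' x, F x * averageOp a e G x := by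
  have h1 : ∀ i, ∑' x, a i * F (e i x) * G x = ∑' x, F x * (a i * G ((e i).symm x)) := fun i => by
    rw [← (e i).tsum_eq fun x => F x * (a i * G ((e i).symm x))]
    refine tsum_congr fun x => ?_
    rw [Equiv.symm_apply_apply]
    ring
  simp only [averageOp, Finset.sum_mul, Finset.mul_sum]
  rw [Summable.tsum_finsetSum fun _ _ => ENNReal.summable,
    Summable.tsum_finsetSum fun _ _ => ENNReal.summable]
  simp only [h1]
  rw [← Equiv.sum_comp σ fun i => ∑' x, F x * (a i * G (e i x))]
  simp only [haσ, heσ]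

lemma tsum_averageOp_iterate_mul {σ : ι ≃ ι} (haσ : ∀ i, a (σ i) = a i)
    (heσ : ∀ i, e (σ i) = (e i).symm) (n : ℕ) (F G : X → ℝ≥0∞) :
    ∑' x, (averageOp a e)^[n] F x * G x = ∑' x, F x * (averageOp a e)^[n] G x := by
  induction n generalizing F G with
  | zero => rfl
  | succ n ih =>
    rw [Function.iterate_succ_apply', tsum_averageOp_mul haσ heσ, ih, ← Function.iterate_succ_apply]

lemma tsum_averageOp (ha : ∑ i, a i = 1) {σ : ι ≃ ι} (haσ : ∀ i, a (σ i) = a i)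
    (heσ : ∀ i, e (σ i) = (e i).symm) (F : X → ℝ≥0∞) :
    ∑' x, averageOp a e F x = ∑' x, F x := by
  simpa [averageOp_const ha] using tsum_averageOp_mul haσ heσ F (fun _ => 1)

lemma rpow_add_mul_le {p : ℝ} (hp : 1 < p) {u w : ℝ≥0∞} (hu : 1 ≤ u) (huw : u + w ≤ 2) :
    (u + w) ^ (1 - p) + ENNReal.ofReal ((p - 1) * 2 ^ (-p)) * w ≤ u ^ (1 - p) := by
  have hne : u + w ≠ ∞ := ne_top_of_le_ne_top (by simp) huw
  obtain ⟨hu', hw'⟩ := ENNReal.add_ne_top.1 hne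
  obtain ⟨u, hu0, rfl⟩ : ∃ r : ℝ, 0 ≤ r ∧ u = ENNReal.ofReal r :=
    ⟨u.toReal, ENNReal.toReal_nonneg, (ENNReal.ofReal_toReal hu').symm⟩
  obtain ⟨w, hw0, rfl⟩ : ∃ r : ℝ, 0 ≤ r ∧ w = ENNReal.ofReal r :=
    ⟨w.toReal, ENNReal.toReal_nonneg, (ENNReal.ofReal_toReal hw').symm⟩
  have h1 : 1 ≤ u := ENNReal.one_le_ofReal.1 hu
  have h2 : u + w ≤ 2 := by
    rwa [← ENNReal.ofReal_add hu0 hw0, ENNReal.ofReal_le_ofNat] at huw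
  have hv : 0 < u + w := by linarith
  have main : (u + w) ^ (1 - p) + (p - 1) * 2 ^ (-p) * w ≤ u ^ (1 - p) := by
    have hlog : (p - 1) * (w / (u + w)) ≤ Real.log (u / (u + w)) * (1 - p) := by
      have := Real.log_le_sub_one_of_pos (div_pos (by linarith : 0 < u) hv)
      have huv : u / (u + w) = 1 - w / (u + w) := by field_simp; ring
      nlinarith
    have hbern : 1 + (p - 1) * (w / (u + w)) ≤ (u / (u + w)) ^ (1 - p) := by
      rw [Real.rpow_def_of_pos (div_pos (by linarith) hv)]
      refine le_trans ?_ (Real.exp_le_exp.2 hlog)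
      rw [add_comm]
      exact Real.add_one_le_exp _
    have h2v : (2 : ℝ) ^ (-p) ≤ (u + w) ^ (-p) :=
      Real.rpow_le_rpow_of_nonpos hv h2 (by linarith)
    have hp1 : 0 ≤ p - 1 := by linarith
    calc (u + w) ^ (1 - p) + (p - 1) * 2 ^ (-p) * w
        ≤ (u + w) ^ (1 - p) + (p - 1) * (u + w) ^ (-p) * w := by gcongr
      _ = (u + w) ^ (1 - p) * (1 + (p - 1) * (w / (u + w))) := by
        rw [sub_eq_add_neg 1 p, Real.rpow_add hv, Real.rpow_one]
        field_simp
      _ ≤ (u + w) ^ (1 - p) * (u / (u + w)) ^ (1 - p) := by gcongr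
      _ = u ^ (1 - p) := by
        rw [← Real.mul_rpow hv.le (by positivity), mul_div_cancel₀ _ hv.ne']
  have hc : 0 ≤ (p - 1) * (2 : ℝ) ^ (-p) := mul_nonneg (by linarith) (by positivity)
  rw [← ENNReal.ofReal_add hu0 hw0, ENNReal.ofReal_rpow_of_pos hv,
    ENNReal.ofReal_rpow_of_pos (by linarith), ← ENNReal.ofReal_mul hc,
    ← ENNReal.ofReal_add (by positivity) (by positivity)]
  exact ENNReal.ofReal_le_ofReal main

/-- A Carleson embedding theorem for the iterates of a symmetric averaging operator. -/
lemma tsum_rpow_iterate_mul_iterate_le {p : ℝ} (hp : 1 < p) (ha : ∑ i, a i = 1) {σ : ι ≃ ι}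
    (haσ : ∀ i, a (σ i) = a i) (heσ : ∀ i, e (σ i) = (e i).symm) (g : ℕ → X → ℝ≥0∞)
    (hg : ∀ n x, ∑ j ∈ Finset.range n, g (j + 1) x ≤ 1) (f : X → ℝ≥0∞) (n : ℕ) :
    ENNReal.ofReal ((p - 1) * 2 ^ (-p)) * ∑ k ∈ Finset.range n,
        ∑' x, (averageOp a e)^[k + 1] f x ^ p * (averageOp a e)^[k + 1] (g (k + 1)) x ≤
      ∑' x, f x ^ p := by
  set Q := averageOp a e with hQdef
  set c := ENNReal.ofReal ((p - 1) * 2 ^ (-p))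
  let m : ℕ → X → ℝ≥0∞ := fun k => (fun _ => 1) + ∑ j ∈ Finset.range k, g (j + 1)
  let v : ℕ → X → ℝ≥0∞ := fun k => Q^[k] (m k)
  have hm1 : ∀ k, (fun _ => 1) ≤ m k := fun k x => by simp [m]
  have hm2 : ∀ k, m k ≤ fun _ => 2 := fun k x => by
    simp only [m, Pi.add_apply, Finset.sum_apply]
    calc (1 : ℝ≥0∞) + _ ≤ 1 + 1 := by gcongr; exact hg k x
      _ = 2 := one_add_one_eq_two
  have hit1 : ∀ j k x, 1 ≤ Q^[j] (m k) x := fun j k x => by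
    have := (averageOp_mono (a := a) (e := e)).iterate j (hm1 k) x
    rwa [averageOp_iterate_const ha] at this
  have hit2 : ∀ j k x, Q^[j] (m k) x ≤ 2 := fun j k x => by
    have := (averageOp_mono (a := a) (e := e)).iterate j (hm2 k) x
    rwa [averageOp_iterate_const ha] at this
  have hne0 : ∀ j k x, Q^[j] (m k) x ≠ 0 := fun j k x =>
    (zero_lt_one.trans_le (hit1 j k x)).ne'
  have hnetop : ∀ j k x, Q^[j] (m k) x ≠ ∞ := fun j k x =>
    ne_top_of_le_ne_top (by simp) (hit2 j k x)
  have hvs : ∀ k, v (k + 1) = Q (v k) + Q^[k + 1] (g (k + 1)) := fun k => by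
    have : m (k + 1) = m k + g (k + 1) := by
      simp only [m, Finset.sum_range_succ, add_assoc]
    simp only [v, this]
    rw [hQdef, averageOp_iterate_add, Function.iterate_succ_apply' _ k (m k)]
  let Ψ : ℕ → X → ℝ≥0∞ := fun k x => Q^[k] f x ^ p * v k x ^ (1 - p)
  have hstep : ∀ k x, Ψ (k + 1) x + c * (Q^[k + 1] f x ^ p * Q^[k + 1] (g (k + 1)) x) ≤
      Q (Ψ k) x := fun k x => by
    have hQv : Q (v k) = Q^[k + 1] (m k) := (Function.iterate_succ_apply' _ _ _).symm
    have h2 : Q (v k) x + Q^[k + 1] (g (k + 1)) x ≤ 2 := by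
      have := hit2 (k + 1) (k + 1) x
      change v (k + 1) x ≤ 2 at this
      rwa [hvs] at this
    have h1 : 1 ≤ Q (v k) x := by rw [hQv]; exact hit1 _ _ _
    calc Ψ (k + 1) x + c * (Q^[k + 1] f x ^ p * Q^[k + 1] (g (k + 1)) x)
        = Q^[k + 1] f x ^ p * ((Q (v k) x + Q^[k + 1] (g (k + 1)) x) ^ (1 - p) +
            c * Q^[k + 1] (g (k + 1)) x) := by
          simp only [Ψ, hvs, Pi.add_apply]
          ring
      _ ≤ Q^[k + 1] f x ^ p * Q (v k) x ^ (1 - p) := by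
          gcongr
          exact rpow_add_mul_le hp h1 h2
      _ ≤ Q (Ψ k) x := by
          rw [Function.iterate_succ_apply']
          exact averageOp_rpow_le hp _ _ (hne0 k k) (hnetop k k) x
            (by rw [← hQdef, hQv]; exact hne0 _ _ _) (by rw [← hQdef, hQv]; exact hnetop _ _ _)
  have hsum : ∀ k, ∑' x, Ψ (k + 1) x +
      c * ∑' x, Q^[k + 1] f x ^ p * Q^[k + 1] (g (k + 1)) x ≤ ∑' x, Ψ k x := fun k => by
    rw [← tsum_averageOp ha haσ heσ (Ψ k), ← ENNReal.tsum_mul_left, ← ENNReal.tsum_add]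
    exact ENNReal.tsum_le_tsum (hstep k)
  have htel : ∑' x, Ψ n x + c * ∑ k ∈ Finset.range n,
      ∑' x, Q^[k + 1] f x ^ p * Q^[k + 1] (g (k + 1)) x ≤ ∑' x, Ψ 0 x := by
    induction n with
    | zero => simp
    | succ n ih =>
      refine le_trans ?_ ih
      rw [Finset.sum_range_succ, mul_add, add_left_comm, add_comm]
      rw [add_comm (∑' x, Ψ n x)]
      refine le_trans (le_of_eq ?_) (add_le_add_right (hsum n) _)
      ring
  refine (le_add_self.trans htel).trans (ENNReal.tsum_le_tsum fun x => ?_)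
  simp [Ψ, v, m]

/-- The maximal inequality for even powers of a symmetric averaging operator. -/
lemma tsum_iSup_iterate_rpow_le {p : ℝ} (hp : 1 < p) (ha : ∑ i, a i = 1) {σ : ι ≃ ι}
    (haσ : ∀ i, a (σ i) = a i) (heσ : ∀ i, e (σ i) = (e i).symm) (f : X → ℝ≥0∞) (n : ℕ) :
    ENNReal.ofReal ((p - 1) * 2 ^ (-p)) *
        ∑' x, ⨆ k < n, (averageOp a e)^[2 * (k + 1)] f x ^ p ≤ ∑' x, f x ^ p := by
  classical
  rcases Nat.eq_zero_or_pos n with rfl | hn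
  · simp
  have hτ : ∀ x, ∃ k ∈ Finset.range n, ∀ j ∈ Finset.range n,
      (averageOp a e)^[2 * (j + 1)] f x ^ p ≤ (averageOp a e)^[2 * (k + 1)] f x ^ p := fun x =>
    Finset.exists_max_image _ _ ⟨0, Finset.mem_range.2 hn⟩
  choose τ hτn hτ using hτ
  let g : ℕ → X → ℝ≥0∞ := fun k x => if τ x + 1 = k then 1 else 0
  have hg : ∀ n x, ∑ j ∈ Finset.range n, g (j + 1) x ≤ 1 := fun n x => by
    simp only [g, _root_.add_left_inj, Finset.sum_ite_eq]
    split_ifs <;> simp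
  refine le_trans ?_ (tsum_rpow_iterate_mul_iterate_le hp ha haσ heσ g hg f n)
  gcongr
  calc ∑' x, ⨆ k < n, (averageOp a e)^[2 * (k + 1)] f x ^ p
      ≤ ∑' x, ∑ k ∈ Finset.range n,
          (averageOp a e)^[k + 1] (fun y => (averageOp a e)^[k + 1] f y ^ p) x * g (k + 1) x := by
        refine ENNReal.tsum_le_tsum fun x => ?_
        refine (iSup₂_le fun k hk => hτ x k (Finset.mem_range.2 hk)).trans ?_
        simp only [g, _root_.add_left_inj, mul_ite, mul_one, mul_zero, Finset.sum_ite_eq, hτn, if_true]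
        rw [two_mul, Function.iterate_add_apply]
        exact averageOp_iterate_rpow_le hp ha _ _ x
    _ = _ := by
        rw [Summable.tsum_finsetSum fun _ _ => ENNReal.summable]
        exact Finset.sum_congr rfl fun k _ => tsum_averageOp_iterate_mul haσ heσ _ _ _

end AverageOp

/-- Fatou's lemma for sums in `ℝ≥0∞`. -/
lemma tsum_liminf_le {X : Type*} [Countable X] (G : ℕ → X → ℝ≥0∞) :
    ∑' x, liminf (fun n => G n x) atTop ≤ liminf (fun n => ∑' x, G n x) atTop := by
  let _ : MeasurableSpace X := ⊤
  have : DiscreteMeasurableSpace X := ⟨fun _ => trivial⟩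
  simp only [← lintegral_count]
  exact lintegral_liminf_le fun n => Measurable.of_discrete

section LazyWalk

variable (d : ℕ) (s : ℝ)

/-- Weights of the lazy simple random walk `1 - s L`. -/
noncomputable def walkWeight : Option (Fin d ⊕ Fin d) → ℝ
  | none => 1 - s * d / 2
  | some _ => s / 4

/-- Translations of the lazy simple random walk. -/
def walkShift : Option (Fin d ⊕ Fin d) → (Fin d → ℤ) ≃ (Fin d → ℤ)
  | none => Equiv.refl _
  | some (Sum.inl k) => Equiv.addRight (stdBasisZ d k)
  | some (Sum.inr k) => (Equiv.addRight (stdBasisZ d k)).symm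

variable {d s}

lemma walkWeight_nonneg (hs : 0 ≤ s) (hsd : s * d ≤ 2) (i) : 0 ≤ walkWeight d s i := by
  cases i with
  | none => simp only [walkWeight]; linarith
  | some i => simp only [walkWeight]; linarith

lemma sum_walkWeight (hs : 0 ≤ s) (hsd : s * d ≤ 2) :
    ∑ i, ENNReal.ofReal (walkWeight d s i) = 1 := by
  rw [← ENNReal.ofReal_sum_of_nonneg fun i _ => walkWeight_nonneg hs hsd i, ENNReal.ofReal_eq_one]
  simp only [walkWeight, Fintype.sum_option, Finset.sum_const,
    Finset.card_univ, Fintype.card_sum, Fintype.card_fin, nsmul_eq_mul]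
  push_cast
  ring

lemma walkWeight_swap (i) :
    walkWeight d s (Equiv.optionCongr (Equiv.sumComm _ _) i) = walkWeight d s i := by
  rcases i with _ | i | i <;> rfl

lemma walkShift_swap (i) :
    walkShift d (Equiv.optionCongr (Equiv.sumComm _ _) i) = (walkShift d i).symm := by
  rcases i with _ | i | i <;> rfl

lemma sub_smul_Lop_eq (f : (Fin d → ℤ) → ℂ) (x : Fin d → ℤ) :
    f x - s * Lop d f x = ∑ i, (walkWeight d s i : ℂ) * f (walkShift d i x) := by
  simp only [Fintype.sum_option, Fintype.sum_sum_type, walkWeight, walkShift, Lop,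
    Equiv.refl_apply, Equiv.coe_addRight, Equiv.addRight_symm, ← sub_eq_add_neg,
    Finset.sum_sub_distrib, ← Finset.mul_sum, Finset.sum_add_distrib, Finset.sum_const,
    Finset.card_univ, Fintype.card_fin, nsmul_eq_mul]
  push_cast
  ring

/-- The operator `Lop d` as a linear map. -/
noncomputable def LopHom (d : ℕ) : Module.End ℂ ((Fin d → ℤ) → ℂ) where
  toFun := Lop d
  map_add' f g := by
    funext x
    simp only [Lop, Pi.add_apply, ← Finset.sum_add_distrib]
    exact Finset.sum_congr rfl fun k _ => by ring
  map_smul' c f := by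
    funext x
    simp only [Lop, Pi.smul_apply, smul_eq_mul, RingHom.id_apply, Finset.mul_sum]
    exact Finset.sum_congr rfl fun k _ => by ring

lemma LopHom_pow_apply (n : ℕ) (f : (Fin d → ℤ) → ℂ) : (LopHom d ^ n) f = (Lop d)^[n] f := by
  rw [Module.End.pow_apply]
  rfl

lemma one_sub_smul_LopHom_pow_apply (n : ℕ) (f : (Fin d → ℤ) → ℂ) (x : Fin d → ℤ) :
    ((1 - (s : ℂ) • LopHom d) ^ n) f x =
      ∑' j : ℕ, (n.choose j * (-s : ℂ) ^ j) * (Lop d)^[j] f x := by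
  rw [tsum_eq_sum (s := Finset.range (n + 1)), sub_eq_add_neg, add_comm,
    ← neg_smul (s : ℂ) (LopHom d), (Commute.one_right _).add_pow]
  · simp only [one_pow, mul_one, smul_pow, LinearMap.sum_apply, Finset.sum_apply]
    refine Finset.sum_congr rfl fun j _ => ?_
    rw [(Nat.commute_cast _ _).eq, ← nsmul_eq_mul, LinearMap.smul_apply, LinearMap.smul_apply,
      LopHom_pow_apply]
    simp only [Pi.smul_apply, nsmul_eq_mul, smul_eq_mul]
    ring
  · intro j hj
    rw [Nat.choose_eq_zero_of_lt (by simpa [Nat.lt_succ_iff] using hj)]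
    simp

lemma enorm_one_sub_smul_LopHom_pow_le (hs : 0 ≤ s) (hsd : s * d ≤ 2) (n : ℕ)
    (f : (Fin d → ℤ) → ℂ) (x : Fin d → ℤ) :
    ‖((1 - (s : ℂ) • LopHom d) ^ n) f x‖ₑ ≤
      (averageOp (fun i => ENNReal.ofReal (walkWeight d s i)) (walkShift d))^[n]
        (fun y => ‖f y‖ₑ) x := by
  induction n generalizing x with
  | zero => simp
  | succ n ih =>
    rw [pow_succ', Module.End.mul_apply, Function.iterate_succ_apply']
    set F := ((1 - (s : ℂ) • LopHom d) ^ n) f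
    have : (1 - (s : ℂ) • LopHom d) F x = F x - s * Lop d F x := rfl
    rw [this, sub_smul_Lop_eq]
    refine (enorm_sum_le _ _).trans (Finset.sum_le_sum fun i _ => ?_)
    rw [enorm_mul]
    gcongr
    · rw [← ofReal_norm, Complex.norm_of_nonneg (walkWeight_nonneg hs hsd i)]
    · exact ih _

end LazyWalk

lemma norm_Lop_iterate_le {d : ℕ} {f : (Fin d → ℤ) → ℂ} {B : ℝ} (hB : ∀ x, ‖f x‖ ≤ B) (n : ℕ)
    (x : Fin d → ℤ) : ‖(Lop d)^[n] f x‖ ≤ d ^ n * B := by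
  induction n generalizing x with
  | zero => simpa using hB x
  | succ n ih =>
    rw [Function.iterate_succ_apply']
    set F := (Lop d)^[n] f
    refine (norm_sum_le_of_le _ fun k _ => (?_ : _ ≤ d ^ n * B)).trans_eq ?_
    · refine (norm_sub_le _ _).trans ?_
      rw [norm_mul, norm_mul]
      have h1 := norm_add_le (F (x + stdBasisZ d k)) (F (x - stdBasisZ d k))
      have h2 := ih x
      have h3 := ih (x + stdBasisZ d k)
      have h4 := ih (x - stdBasisZ d k)
      norm_num
      linarith
    · simp only [Finset.sum_const, Finset.card_univ, Fintype.card_fin, nsmul_eq_mul]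
      ring

lemma tendsto_choose_mul_pow {m : ℕ → ℕ} {s : ℕ → ℝ} {t : ℝ} (hs : Tendsto s atTop (𝓝 0))
    (hms : Tendsto (fun n => m n * s n) atTop (𝓝 t)) (j : ℕ) :
    Tendsto (fun n => (m n).choose j * (-s n) ^ j) atTop (𝓝 ((-t) ^ j / j.factorial)) := by
  have hprod : ∀ n, ((m n).choose j : ℝ) * (-s n) ^ j =
      (∏ i ∈ Finset.range j, -(m n * s n - i * s n)) / j.factorial := fun n => by
    rw [Nat.cast_choose_eq_descPochhammer_div, descPochhammer_eval_eq_prod_range, div_mul_eq_mul_div,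
      ← Finset.card_range j, ← Finset.prod_const, Finset.card_range,
      ← Finset.prod_mul_distrib]
    exact congrArg (· / _) (Finset.prod_congr rfl fun i _ => by ring)
  simp only [hprod]
  refine Tendsto.div_const ?_ _
  have : (-t) ^ j = ∏ i ∈ Finset.range j, -(t - i * 0) := by simp
  rw [this]
  exact tendsto_finsetProd _ fun i _ => (hms.sub (hs.const_mul _)).neg

lemma tendsto_one_sub_smul_LopHom_pow {d : ℕ} {f : (Fin d → ℤ) → ℂ} {B : ℝ}
    (hB : ∀ x, ‖f x‖ ≤ B) {m : ℕ → ℕ} {s : ℕ → ℝ} {t : ℝ} (hs0 : ∀ n, 0 ≤ s n)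
    (hs : Tendsto s atTop (𝓝 0)) (hms : Tendsto (fun n => m n * s n) atTop (𝓝 t))
    (x : Fin d → ℤ) :
    Tendsto (fun n => ((1 - (s n : ℂ) • LopHom d) ^ m n) f x) atTop
      (𝓝 (heatSemigroup d t f x)) := by
  simp only [one_sub_smul_LopHom_pow_apply, heatSemigroup]
  refine tendsto_tsum_of_dominated_convergence
    (bound := fun j => ((t + 1) * d) ^ j / j.factorial * B)
    ((Real.summable_pow_div_factorial _).mul_right _) (fun j => ?_) ?_
  · refine Tendsto.mul_const _ ?_
    have := (Complex.continuous_ofReal.tendsto _).comp (tendsto_choose_mul_pow hs hms j)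
    simpa [Function.comp_def] using this
  · filter_upwards [hms.eventually_le_const (lt_add_one t)] with n hn j
    have hB0 : 0 ≤ B := (norm_nonneg _).trans (hB x)
    rw [norm_mul, norm_mul, norm_pow, norm_neg, Complex.norm_of_nonneg (hs0 n),
      Complex.norm_natCast]
    calc ((m n).choose j : ℝ) * s n ^ j * ‖(Lop d)^[j] f x‖
        ≤ ((m n : ℝ) ^ j / j.factorial) * s n ^ j * (d ^ j * B) := by
          have := hs0 n
          gcongr
          · exact Nat.choose_le_pow_div _ _
          · exact norm_Lop_iterate_le hB j x
      _ = (m n * s n) ^ j * d ^ j / j.factorial * B := by ring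
      _ ≤ (t + 1) ^ j * d ^ j / j.factorial * B := by
          have := mul_nonneg (Nat.cast_nonneg (α := ℝ) (m n)) (hs0 n)
          gcongr
      _ = _ := by rw [mul_pow]

lemma tsum_iSup_heatSemigroup_rpow_le {p : ℝ} (hp : 1 < p) {d : ℕ} {f : (Fin d → ℤ) → ℂ} {B : ℝ}
    (hB : ∀ x, ‖f x‖ ≤ B) :
    ENNReal.ofReal ((p - 1) * 2 ^ (-p)) *
        ∑' x, (⨆ (t : ℝ) (_ : 0 < t), ‖heatSemigroup d t f x‖ₑ) ^ p ≤ ∑' x, ‖f x‖ₑ ^ p := by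
  have hp0 : 0 < p := by linarith
  let s : ℕ → ℝ := fun n => 1 / ((n + d : ℕ) : ℝ)
  have hs0 : ∀ n, 0 ≤ s n := fun n => by positivity
  have hsd : ∀ n, s n * d ≤ 2 := fun n => by
    have : s n * d ≤ 1 := by
      simp only [s, one_div_mul_eq_div]
      exact div_le_one_of_le₀ (by simp) (by positivity)
    linarith
  have hsinv : Tendsto (fun n : ℕ => ((n + d : ℕ) : ℝ)) atTop atTop :=
    tendsto_natCast_atTop_atTop.comp (tendsto_add_atTop_nat d)
  have hs : Tendsto s atTop (𝓝 0) := by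
    simpa only [s, one_div, Function.comp_def] using tendsto_inv_atTop_zero.comp hsinv
  let Q : ℕ → ((Fin d → ℤ) → ℝ≥0∞) → ((Fin d → ℤ) → ℝ≥0∞) := fun n =>
    averageOp (fun i => ENNReal.ofReal (walkWeight d (s n) i)) (walkShift d)
  let G : ℕ → (Fin d → ℤ) → ℝ≥0∞ := fun n x =>
    ⨆ k < (n + d) ^ 2, (Q n)^[2 * (k + 1)] (fun y => ‖f y‖ₑ) x ^ p
  have hG : ∀ x, (⨆ (t : ℝ) (_ : 0 < t), ‖heatSemigroup d t f x‖ₑ) ^ p ≤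
      liminf (fun n => G n x) atTop := fun x => by
    rw [← ENNReal.le_rpow_inv_iff hp0]
    refine iSup₂_le fun t ht => ?_
    rw [ENNReal.le_rpow_inv_iff hp0]
    let k : ℕ → ℕ := fun n => ⌊t / 2 * ((n + d : ℕ) : ℝ)⌋₊
    have hk : Tendsto (fun n => ((2 * (k n + 1) : ℕ) : ℝ) * s n) atTop (𝓝 t) := by
      have h1 : Tendsto (fun n => (k n : ℝ) * s n) atTop (𝓝 (t / 2)) := by
        have := (tendsto_nat_floor_mul_div_atTop (by positivity : 0 ≤ t / 2)).comp hsinv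
        simpa [Function.comp_def, s, k, div_eq_mul_inv] using this
      have h2 := (h1.add hs).const_mul 2
      rw [add_zero, mul_div_cancel₀ t two_ne_zero] at h2
      refine h2.congr fun n => ?_
      push_cast
      ring
    have hlim := (tendsto_one_sub_smul_LopHom_pow hB hs0 hs hk x).enorm.ennrpow_const p
    rw [← hlim.liminf_eq]
    refine liminf_le_liminf ?_
    filter_upwards [hsinv.eventually_ge_atTop t, hsinv.eventually_ge_atTop 1] with n hn hn1
    refine le_trans ?_ (le_iSup₂ (f := fun k _ => (Q n)^[2 * (k + 1)] (fun y => ‖f y‖ₑ) x ^ p)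
      (k n) ?_)
    · gcongr
      exact enorm_one_sub_smul_LopHom_pow_le (hs0 n) (hsd n) _ f x
    · rw [Nat.floor_lt (by positivity)]
      push_cast at *
      nlinarith
  calc ENNReal.ofReal ((p - 1) * 2 ^ (-p)) *
        ∑' x, (⨆ (t : ℝ) (_ : 0 < t), ‖heatSemigroup d t f x‖ₑ) ^ p
      ≤ ENNReal.ofReal ((p - 1) * 2 ^ (-p)) * liminf (fun n => ∑' x, G n x) atTop := by
        gcongr
        exact (ENNReal.tsum_le_tsum hG).trans (tsum_liminf_le G)
    _ = liminf (fun n => ENNReal.ofReal ((p - 1) * 2 ^ (-p)) * ∑' x, G n x) atTop :=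
        (ENNReal.liminf_const_mul_of_ne_top ENNReal.ofReal_ne_top).symm
    _ ≤ ∑' x, ‖f x‖ₑ ^ p := by
        refine liminf_le_of_le (by isBoundedDefault) fun b hb => ?_
        obtain ⟨n, hn⟩ := hb.exists
        exact hn.trans (tsum_iSup_iterate_rpow_le hp (sum_walkWeight (hs0 n) (hsd n))
          (fun i => by rw [walkWeight_swap]) walkShift_swap _ _)

/-- Dimension-free `ℓ_p` maximal inequality, `1 < p < ∞`, for the discrete
heat-type semigroup `e^{-tL}` on `ℤ^d`. -/
theorem dimension_free_semigroup_maximal (p : ℝ) (hp : 1 < p) :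
    ∃ C : ℝ, 0 < C ∧
      ∀ d : ℕ, 1 ≤ d → ∀ f : (Fin d → ℤ) → ℂ,
        lpNorm d p
            (fun x => ⨆ (t : ℝ) (_ : 0 < t), (‖heatSemigroup d t f x‖₊ : ℝ≥0∞)) ≤
          ENNReal.ofReal C * lpNorm d p (fun x => (‖f x‖₊ : ℝ≥0∞)) := by
  have hp0 : 0 < p := by linarith
  set c : ℝ := (p - 1) * 2 ^ (-p)
  have hc0 : 0 < c := mul_pos (by linarith) (by positivity)
  refine ⟨c⁻¹ ^ (1 / p), by positivity, fun d _ f => ?_⟩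
  simp only [_root_.lpNorm, ← enorm_eq_nnnorm]
  by_cases hf : ∑' x, ‖f x‖ₑ ^ p = ∞
  · rw [hf, ENNReal.top_rpow_of_pos (by positivity), ENNReal.mul_top]
    · exact le_top
    · rw [Ne, ENNReal.ofReal_eq_zero, not_le]
      positivity
  have hB : ∀ x, ‖f x‖ ≤ ((∑' x, ‖f x‖ₑ ^ p) ^ (1 / p)).toReal := fun x => by
    rw [← toReal_enorm]
    refine ENNReal.toReal_mono (ENNReal.rpow_ne_top_of_nonneg (by positivity) hf) ?_
    rw [one_div, ENNReal.le_rpow_inv_iff hp0]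
    exact ENNReal.le_tsum x
  have key := tsum_iSup_heatSemigroup_rpow_le hp hB
  rw [← ENNReal.ofReal_rpow_of_pos (by positivity), ← ENNReal.mul_rpow_of_nonneg _ _ (by positivity)]
  gcongr
  rw [ENNReal.ofReal_inv_of_pos hc0, mul_comm, ← div_eq_mul_inv,
    ENNReal.le_div_iff_mul_le (by simp [hc0]) (by simp), mul_comm]
  exact key
end

section
/- Let c₀ > 0 and set 𝔻_{c₀} = {N ∈ 𝔻 : N ≤ c₀ d^{1/2}}. There exists a constant C > 0 depending only on c₀ (independent of the dimension d) such that for every d ≥ 1 and every f ∈ ℓ₂(ℤ^d; ℂ), ‖ sup_{N ∈ 𝔻_{c₀}} |M_N^B f| ‖_{ℓ₂(ℤ^d)} ≤ C ‖f‖_{ℓ₂(ℤ^d)}. (Scalar-valued case of Lemma 3.4, the small-scale estimate.) -/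
open MeasureTheory ENNReal

/-- The set of lattice points in the closed Euclidean ball of radius `N`
centered at the origin of `ℝ^d`. -/
def latticeBallSet (d : ℕ) (N : ℝ) : Set (Fin d → ℤ) :=
  {y | ∑ j, ((y j : ℝ)) ^ 2 ≤ N ^ 2}

/-- The discrete Hardy–Littlewood averaging operator over the Euclidean ball
of radius `N`: `M_N^B f (x) = (1/#(B_N ∩ ℤ^d)) ∑_{y ∈ B_N ∩ ℤ^d} f (x - y)`. -/
noncomputable def ballAvg (d : ℕ) (N : ℝ) (f : (Fin d → ℤ) → ℂ) (x : Fin d → ℤ) : ℂ :=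
  (∑ᶠ y ∈ latticeBallSet d N, f (x - y)) / ((latticeBallSet d N).ncard : ℂ)

open AddMonoidAlgebra UnitAddTorus

section Convolution

variable {d : ℕ}

lemma integral_fourier_haar (n : ℤ) :
    ∫ x : UnitAddCircle, fourier n x ∂AddCircle.haarAddCircle = if n = 0 then (1 : ℂ) else 0 := by
  have h := congrFun (fourierCoeff_fourier (T := (1 : ℝ)) n) 0
  simp only [fourierCoeff, neg_zero, fourier_zero, one_smul] at h
  rw [h]
  simp [Pi.single_apply, eq_comm]

/-- The Haar probability measure on the torus. -/
noncomputable def torusMeasure (d : ℕ) : Measure (UnitAddTorus (Fin d)) :=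
  Measure.pi fun _ => AddCircle.haarAddCircle

instance : IsProbabilityMeasure (torusMeasure d) := by
  unfold torusMeasure; infer_instance

lemma integral_mFourier (y : Fin d → ℤ) :
    ∫ x, mFourier y x ∂torusMeasure d = if y = 0 then (1 : ℂ) else 0 := by
  have : ∀ x : UnitAddTorus (Fin d), mFourier y x = ∏ i, fourier (y i) (x i) := fun _ => rfl
  simp_rw [this, torusMeasure]
  rw [integral_fintype_prod_eq_prod (f := fun i x => (fourier (y i) x : ℂ))]
  simp_rw [integral_fourier_haar]
  rw [Finset.prod_ite_zero]
  simp [funext_iff]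

lemma integrable_torus (u : C(UnitAddTorus (Fin d), ℂ)) : Integrable u (torusMeasure d) :=
  u.continuous.integrable_of_hasCompactSupport (HasCompactSupport.of_compactSpace _)

/-- The Fourier transform of a finitely supported function on `ℤ^d`. -/
noncomputable def fourierHat (d : ℕ) :
    AddMonoidAlgebra ℝ (Fin d → ℤ) →ₐ[ℝ] C(UnitAddTorus (Fin d), ℂ) :=
  AddMonoidAlgebra.lift ℝ C(UnitAddTorus (Fin d), ℂ) (Fin d → ℤ)
    { toFun := fun y => mFourier y.toAdd
      map_one' := mFourier_zero
      map_mul' := fun x y => by ext t; exact mFourier_add }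

lemma fourierHat_single (y : Fin d → ℤ) (r : ℝ) :
    fourierHat d (single y r) = r • mFourier y := by
  rw [fourierHat, AddMonoidAlgebra.lift_single]; rfl

/-- The `ℓ²` inner product of finitely supported functions. -/
noncomputable def innerForm (d : ℕ) :
    AddMonoidAlgebra ℝ (Fin d → ℤ) →ₗ[ℝ] AddMonoidAlgebra ℝ (Fin d → ℤ) →ₗ[ℝ] ℝ :=
  LinearMap.mk₂ ℝ (fun a b => a.coeff.sum fun x r => r * b.coeff x)
    (fun a a' b => by
      simp only [coeff_add]
      exact Finsupp.sum_add_index' (by simp) (by intros; ring))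
    (fun c a b => by
      simp only [coeff_smul]
      rw [Finsupp.sum_smul_index (by simp), Finsupp.smul_sum]
      simp [mul_assoc])
    (fun a b b' => by
      simp only [coeff_add, Finsupp.add_apply, mul_add]
      exact Finsupp.sum_add)
    (fun c a b => by
      simp only [Finsupp.sum, coeff_smul, Finsupp.smul_apply, smul_eq_mul, Finset.mul_sum]
      exact Finset.sum_congr rfl fun _ _ => by ring)

lemma innerForm_apply (a b : AddMonoidAlgebra ℝ (Fin d → ℤ)) :
    innerForm d a b = ∑ x ∈ a.coeff.support, a.coeff x * b.coeff x := rfl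

lemma innerForm_eq_sum {a b : AddMonoidAlgebra ℝ (Fin d → ℤ)} {F : Finset (Fin d → ℤ)}
    (hF : a.coeff.support ⊆ F) : innerForm d a b = ∑ x ∈ F, a.coeff x * b.coeff x := by
  rw [innerForm_apply]
  refine Finset.sum_subset hF fun x _ hx => ?_
  simp [Finsupp.notMem_support_iff.mp hx]

lemma innerForm_eq_integral (a b : AddMonoidAlgebra ℝ (Fin d → ℤ)) :
    ((innerForm d a b : ℝ) : ℂ) =
      ∫ t, fourierHat d a t * star (fourierHat d b) t ∂torusMeasure d := by
  have hadd : ∀ u v : C(UnitAddTorus (Fin d), ℂ),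
      ∫ t, (u t + v t) ∂torusMeasure d = ∫ t, u t ∂torusMeasure d + ∫ t, v t ∂torusMeasure d :=
    fun u v => integral_add (integrable_torus u) (integrable_torus v)
  induction a using AddMonoidAlgebra.induction_linear with
  | zero => simp
  | add a a' ha ha' =>
    rw [map_add, LinearMap.add_apply, Complex.ofReal_add, ha, ha', map_add]
    simp only [ContinuousMap.add_apply, add_mul]
    exact (hadd (fourierHat d a * star (fourierHat d b))
      (fourierHat d a' * star (fourierHat d b))).symm
  | single x r =>
    induction b using AddMonoidAlgebra.induction_linear with
    | zero => simp
    | add b b' hb hb' =>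
      rw [map_add, Complex.ofReal_add, hb, hb', map_add, star_add]
      simp only [ContinuousMap.add_apply, mul_add]
      exact (hadd (fourierHat d (single x r) * star (fourierHat d b))
        (fourierHat d (single x r) * star (fourierHat d b'))).symm
    | single y s =>
      have h1 : ∀ t, fourierHat d (single x r) t * star (fourierHat d (single y s)) t
          = ((r * s : ℝ) : ℂ) * mFourier (x + -y) t := by
        intro t
        rw [fourierHat_single, fourierHat_single, mFourier_add, mFourier_neg]
        simp
        ring
      simp_rw [h1]
      rw [integral_const_mul, integral_mFourier, innerForm_eq_sum (F := {x})]
      · by_cases hxy : y = x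
        · simp [hxy, coeff_single]
        · have : ¬ (x + -y = 0) := fun h => hxy (by rw [← sub_eq_add_neg, sub_eq_zero] at h; exact h.symm)
          simp [hxy, this, coeff_single]
      · rw [coeff_single]; exact Finsupp.support_single_subset

lemma innerForm_self_eq_integral (a : AddMonoidAlgebra ℝ (Fin d → ℤ)) :
    innerForm d a a = ∫ t, ‖fourierHat d a t‖ ^ 2 ∂torusMeasure d := by
  have h := innerForm_eq_integral a a
  have h2 : ∀ t, fourierHat d a t * star (fourierHat d a) t
      = ((‖fourierHat d a t‖ ^ 2 : ℝ) : ℂ) := fun t => by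
    rw [ContinuousMap.star_apply]
    simpa using Complex.mul_conj' (fourierHat d a t)
  simp_rw [h2] at h
  rw [integral_complex_ofReal] at h
  exact_mod_cast h

lemma innerForm_self_nonneg (a : AddMonoidAlgebra ℝ (Fin d → ℤ)) : 0 ≤ innerForm d a a := by
  rw [innerForm_apply]
  exact Finset.sum_nonneg fun x _ => mul_self_nonneg _

lemma innerForm_comm (a b : AddMonoidAlgebra ℝ (Fin d → ℤ)) :
    innerForm d a b = innerForm d b a := by
  classical
  rw [innerForm_eq_sum (F := a.coeff.support ∪ b.coeff.support) Finset.subset_union_left,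
    innerForm_eq_sum (F := a.coeff.support ∪ b.coeff.support) Finset.subset_union_right]
  simp_rw [mul_comm]

lemma innerForm_mono {a b b' : AddMonoidAlgebra ℝ (Fin d → ℤ)} (ha : ∀ x, 0 ≤ a.coeff x)
    (hb : ∀ x, b.coeff x ≤ b'.coeff x) : innerForm d a b ≤ innerForm d a b' := by
  rw [innerForm_apply, innerForm_apply]
  exact Finset.sum_le_sum fun x _ => mul_le_mul_of_nonneg_left (hb x) (ha x)

lemma innerForm_nonneg {a b : AddMonoidAlgebra ℝ (Fin d → ℤ)} (ha : ∀ x, 0 ≤ a.coeff x)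
    (hb : ∀ x, 0 ≤ b.coeff x) : 0 ≤ innerForm d a b := by
  rw [innerForm_apply]
  exact Finset.sum_nonneg fun x _ => mul_nonneg (ha x) (hb x)

lemma coeff_mul_nonneg {a b : AddMonoidAlgebra ℝ (Fin d → ℤ)} (ha : ∀ x, 0 ≤ a.coeff x)
    (hb : ∀ x, 0 ≤ b.coeff x) (x : Fin d → ℤ) : 0 ≤ (a * b).coeff x := by
  classical
  rw [coeff_mul]
  refine Finset.sum_nonneg fun y _ => Finset.sum_nonneg fun z _ => ?_
  dsimp only
  split_ifs
  · exact mul_nonneg (ha _) (hb _)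
  · exact le_rfl

lemma coeff_mul_le_mul_right {a a' b : AddMonoidAlgebra ℝ (Fin d → ℤ)}
    (ha : ∀ x, a.coeff x ≤ a'.coeff x) (hb : ∀ x, 0 ≤ b.coeff x) (x : Fin d → ℤ) :
    (a * b).coeff x ≤ (a' * b).coeff x := by
  have h := coeff_mul_nonneg (a := a' - a) (b := b)
    (fun x => by rw [coeff_sub, Finsupp.sub_apply]; exact sub_nonneg.mpr (ha x)) hb x
  rw [sub_mul, coeff_sub, Finsupp.sub_apply] at h
  linarith

lemma innerForm_le_half (a b : AddMonoidAlgebra ℝ (Fin d → ℤ)) {c : ℝ} (hc : 0 < c) :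
    2 * innerForm d a b ≤ c * innerForm d a a + c⁻¹ * innerForm d b b := by
  have h := innerForm_self_nonneg (c • a - b)
  simp only [map_sub, map_smul, LinearMap.sub_apply, LinearMap.smul_apply, smul_eq_mul] at h
  rw [innerForm_comm b a] at h
  have h2 := mul_nonneg (inv_nonneg.mpr hc.le) h
  field_simp at h2 ⊢
  linarith

lemma innerForm_mul_self_le {a b : AddMonoidAlgebra ℝ (Fin d → ℤ)} {S : ℝ}
    (hS : ∀ t, ‖fourierHat d a t‖ ≤ S) :
    innerForm d (a * b) (a * b) ≤ S ^ 2 * innerForm d b b := by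
  rw [innerForm_self_eq_integral, innerForm_self_eq_integral, ← integral_const_mul]
  have hint : ∀ u : C(UnitAddTorus (Fin d), ℂ), Integrable (fun t => ‖u t‖ ^ 2) (torusMeasure d) :=
    fun u => Continuous.integrable_of_hasCompactSupport (by fun_prop)
      (HasCompactSupport.of_compactSpace _)
  refine integral_mono (hint _) ((hint _).const_mul _) fun t => ?_
  simp only [map_mul, ContinuousMap.mul_apply, norm_mul, mul_pow]
  gcongr
  exact hS t

lemma innerForm_mul_sub_le {k k' q a b : AddMonoidAlgebra ℝ (Fin d → ℤ)} {ε : ℝ}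
    (h : ∀ t, ‖fourierHat d k t‖ * ‖fourierHat d k' t - fourierHat d q t‖ ≤ ε) :
    innerForm d (k * a) (k' * b) ≤ innerForm d (k * a) (q * b) +
      ε * ((innerForm d a a + innerForm d b b) / 2) := by
  have hint : ∀ u : C(UnitAddTorus (Fin d), ℂ), Integrable (fun t => ‖u t‖ ^ 2) (torusMeasure d) :=
    fun u => Continuous.integrable_of_hasCompactSupport (by fun_prop)
      (HasCompactSupport.of_compactSpace _)
  have h1 : innerForm d (k * a) (k' * b) - innerForm d (k * a) (q * b)
      = innerForm d (k * a) ((k' - q) * b) := by rw [sub_mul, map_sub]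
  have h2 : |innerForm d (k * a) ((k' - q) * b)| ≤
      ε * ((innerForm d a a + innerForm d b b) / 2) := by
    have h3 : |innerForm d (k * a) ((k' - q) * b)| =
        ‖((innerForm d (k * a) ((k' - q) * b) : ℝ) : ℂ)‖ := by simp
    rw [h3, innerForm_eq_integral, innerForm_self_eq_integral, innerForm_self_eq_integral,
      ← integral_add (hint _) (hint _), ← integral_div, ← integral_const_mul]
    refine norm_integral_le_of_norm_le ((((hint _).add (hint _)).div_const 2).const_mul ε)
      (Filter.Eventually.of_forall fun t => ?_)
    have h4 := h t
    simp only [map_mul, map_sub, ContinuousMap.mul_apply, ContinuousMap.star_apply, norm_mul,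
      norm_star, ContinuousMap.sub_apply]
    have h5 : ‖fourierHat d a t‖ * ‖fourierHat d b t‖ ≤
        (‖fourierHat d a t‖ ^ 2 + ‖fourierHat d b t‖ ^ 2) / 2 := by
      nlinarith [sq_nonneg (‖fourierHat d a t‖ - ‖fourierHat d b t‖)]
    have h6 : 0 ≤ ε := le_trans (by positivity) h4
    calc _ = (‖fourierHat d k t‖ * ‖fourierHat d k' t - fourierHat d q t‖) *
          (‖fourierHat d a t‖ * ‖fourierHat d b t‖) := by ring
      _ ≤ _ := mul_le_mul h4 h5 (by positivity) h6
  have := le_abs_self (innerForm d (k * a) ((k' - q) * b))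
  linarith

lemma sum_mul_quarter_pow_le (I : Finset ℕ) (w : ℕ → ℝ) (hw : ∀ n, 0 ≤ w n) :
    ∑ n ∈ I, ∑ m ∈ I with m ≤ n, (1 / 4 : ℝ) ^ (n - m) * ((w n + w m) / 2) ≤
      2 * ∑ n ∈ I, w n := by
  have hgeom : ∀ J : Finset ℕ, ∑ j ∈ J, (1 / 4 : ℝ) ^ j ≤ 2 := fun J => by
    calc ∑ j ∈ J, (1 / 4 : ℝ) ^ j ≤ ∑' j : ℕ, (1 / 4 : ℝ) ^ j :=
          (summable_geometric_of_lt_one (by norm_num) (by norm_num)).sum_le_tsum _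
            fun _ _ => by positivity
      _ ≤ 2 := by rw [tsum_geometric_of_lt_one (by norm_num) (by norm_num)]; norm_num
  have hinj1 : ∀ n, ∑ m ∈ I with m ≤ n, (1 / 4 : ℝ) ^ (n - m) ≤ 2 := fun n => by
    have := hgeom ((I.filter (· ≤ n)).image (n - ·))
    rwa [Finset.sum_image] at this
    intro a ha b hb hab
    simp only [Finset.coe_filter, Set.mem_ofPred_eq] at ha hb hab
    omega
  have hinj2 : ∀ m, ∑ n ∈ I with m ≤ n, (1 / 4 : ℝ) ^ (n - m) ≤ 2 := fun m => by
    have := hgeom ((I.filter (m ≤ ·)).image (· - m))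
    rwa [Finset.sum_image] at this
    intro a ha b hb hab
    simp only [Finset.coe_filter, Set.mem_ofPred_eq] at ha hb hab
    omega
  have hsplit : ∑ n ∈ I, ∑ m ∈ I with m ≤ n, (1 / 4 : ℝ) ^ (n - m) * ((w n + w m) / 2) =
      (∑ n ∈ I, (∑ m ∈ I with m ≤ n, (1 / 4 : ℝ) ^ (n - m)) * w n) / 2 +
      (∑ n ∈ I, (∑ m ∈ I with n ≤ m, (1 / 4 : ℝ) ^ (m - n)) * w n) / 2 := by
    have hswap : ∑ n ∈ I, ∑ m ∈ I with m ≤ n, (1 / 4 : ℝ) ^ (n - m) * w m =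
        ∑ n ∈ I, (∑ m ∈ I with n ≤ m, (1 / 4 : ℝ) ^ (m - n)) * w n := by
      simp_rw [Finset.sum_mul, Finset.sum_filter]
      exact Finset.sum_comm
    rw [← hswap]
    simp_rw [Finset.sum_mul, Finset.sum_div]
    rw [← Finset.sum_add_distrib]
    refine Finset.sum_congr rfl fun n _ => ?_
    rw [← Finset.sum_add_distrib]
    exact Finset.sum_congr rfl fun m _ => by ring
  have hA : ∑ n ∈ I, (∑ m ∈ I with m ≤ n, (1 / 4 : ℝ) ^ (n - m)) * w n ≤ ∑ n ∈ I, 2 * w n :=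
    Finset.sum_le_sum fun n _ => mul_le_mul_of_nonneg_right (hinj1 n) (hw n)
  have hB : ∑ n ∈ I, (∑ m ∈ I with n ≤ m, (1 / 4 : ℝ) ^ (m - n)) * w n ≤ ∑ n ∈ I, 2 * w n :=
    Finset.sum_le_sum fun n _ => mul_le_mul_of_nonneg_right (hinj2 n) (hw n)
  rw [← Finset.mul_sum] at hA hB
  linarith

/-- A `T T*` argument: if `k n * k m` is dominated by `k n * s` for `m ≤ n` up to an error which
decays geometrically in `n - m` on the Fourier side, then the adjoint of the linearized maximal
operator with kernels `k n` is bounded on `ℓ²`. -/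
theorem innerForm_sum_mul_le (I : Finset ℕ) (k q g : ℕ → AddMonoidAlgebra ℝ (Fin d → ℤ))
    (s : AddMonoidAlgebra ℝ (Fin d → ℤ)) {A : ℝ} (hA : 0 ≤ A)
    (hk : ∀ n x, 0 ≤ (k n).coeff x) (hs : ∀ x, 0 ≤ s.coeff x)
    (hqs : ∀ n x, (q n).coeff x ≤ s.coeff x) (hg : ∀ n x, 0 ≤ (g n).coeff x)
    (hs2 : ∀ t, ‖fourierHat d s t‖ ≤ 2)
    (h : ∀ n ∈ I, ∀ m ∈ I, m ≤ n → ∀ t,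
      ‖fourierHat d (k n) t‖ * ‖fourierHat d (k m) t - fourierHat d (q m) t‖ ≤
        A * (1 / 4) ^ (n - m)) :
    innerForm d (∑ n ∈ I, k n * g n) (∑ n ∈ I, k n * g n) ≤
      (16 + 8 * A) * innerForm d (∑ n ∈ I, g n) (∑ n ∈ I, g n) := by
  set T := ∑ n ∈ I, k n * g n with hT
  set U := ∑ n ∈ I, g n with hU
  have hkg : ∀ n x, 0 ≤ (k n * g n).coeff x := fun n => coeff_mul_nonneg (hk n) (hg n)
  have hsg : ∀ n x, 0 ≤ (s * g n).coeff x := fun n => coeff_mul_nonneg hs (hg n)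
  have hexp : ∀ a b : ℕ → AddMonoidAlgebra ℝ (Fin d → ℤ),
      innerForm d (∑ n ∈ I, a n) (∑ n ∈ I, b n) = ∑ n ∈ I, ∑ m ∈ I, innerForm d (a n) (b m) := by
    intro a b
    simp_rw [map_sum, LinearMap.sum_apply]
    exact Finset.sum_comm
  have hsub : ∀ a b : ℕ → AddMonoidAlgebra ℝ (Fin d → ℤ), (∀ n x, 0 ≤ (a n).coeff x) →
      (∀ n x, 0 ≤ (b n).coeff x) →
      ∑ n ∈ I, ∑ m ∈ I with m ≤ n, innerForm d (a n) (b m) ≤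
        ∑ n ∈ I, ∑ m ∈ I, innerForm d (a n) (b m) := fun a b ha hb =>
    Finset.sum_le_sum fun n _ => Finset.sum_le_sum_of_subset_of_nonneg (Finset.filter_subset _ _)
      fun m _ _ => innerForm_nonneg (ha n) (hb m)
  have h1 : innerForm d T T ≤
      2 * ∑ n ∈ I, ∑ m ∈ I with m ≤ n, innerForm d (k n * g n) (k m * g m) := by
    have hsw : ∑ n ∈ I, ∑ m ∈ I with m ≤ n, innerForm d (k n * g n) (k m * g m) =
        ∑ n ∈ I, ∑ m ∈ I with n ≤ m, innerForm d (k n * g n) (k m * g m) := by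
      simp_rw [Finset.sum_filter]
      rw [Finset.sum_comm]
      refine Finset.sum_congr rfl fun n _ => Finset.sum_congr rfl fun m _ => ?_
      rw [innerForm_comm]
    rw [two_mul]
    nth_rewrite 2 [hsw]
    rw [hT, hexp, ← Finset.sum_add_distrib]
    refine Finset.sum_le_sum fun n _ => ?_
    simp_rw [Finset.sum_filter]
    rw [← Finset.sum_add_distrib]
    refine Finset.sum_le_sum fun m _ => ?_
    have h0 := innerForm_nonneg (hkg n) (hkg m)
    rcases le_total n m with hnm | hnm <;> simp only [hnm, if_true] <;> split_ifs <;> linarith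
  have h2 : ∑ n ∈ I, ∑ m ∈ I with m ≤ n, innerForm d (k n * g n) (k m * g m) ≤
      innerForm d T (s * U) + A * (2 * ∑ n ∈ I, innerForm d (g n) (g n)) := by
    have h3 : innerForm d T (s * U) = ∑ n ∈ I, ∑ m ∈ I, innerForm d (k n * g n) (s * g m) := by
      rw [hT, hU, Finset.mul_sum, hexp]
    rw [h3]
    refine le_trans ?_ (add_le_add (hsub (fun n => k n * g n) (fun m => s * g m) hkg hsg)
      (mul_le_mul_of_nonneg_left
        (sum_mul_quarter_pow_le I (fun n => innerForm d (g n) (g n))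
          fun n => innerForm_self_nonneg _) hA))
    rw [Finset.mul_sum, ← Finset.sum_add_distrib]
    refine Finset.sum_le_sum fun n hn => ?_
    rw [Finset.mul_sum, ← Finset.sum_add_distrib]
    refine Finset.sum_le_sum fun m hm => ?_
    rw [Finset.mem_filter] at hm
    refine (innerForm_mul_sub_le (h n hn m hm.1 hm.2)).trans ?_
    have := innerForm_mono (hkg n) (coeff_mul_le_mul_right (hqs m) (hg m))
    linarith
  have h4 : ∑ n ∈ I, innerForm d (g n) (g n) ≤ innerForm d U U := by
    rw [hU, hexp]
    exact Finset.sum_le_sum fun n hn => Finset.single_le_sum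
      (f := fun m => innerForm d (g n) (g m)) (fun m _ => innerForm_nonneg (hg n) (hg m)) hn
  have h5 := innerForm_le_half T (s * U) (c := 1 / 2) (by norm_num)
  have h6 := innerForm_mul_self_le (b := U) hs2
  have h7 := mul_le_mul_of_nonneg_left h4 hA
  norm_num at h5
  linarith

end Convolution

section Symmetrization

/-- Averaging over a finite family of bijections preserving a finite set does not change the sum. -/
lemma sum_eq_sum_average {Y R : Type*} [Fintype R] [Nonempty R] (B : Finset Y) (T : R → Y ≃ Y)
    (hT : ∀ r y, T r y ∈ B ↔ y ∈ B) (Φ : Y → ℂ) :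
    ∑ y ∈ B, Φ y = ∑ y ∈ B, (Fintype.card R : ℂ)⁻¹ * ∑ r, Φ (T r y) := by
  rw [← Finset.mul_sum, Finset.sum_comm]
  have : ∀ r, ∑ y ∈ B, Φ (T r y) = ∑ y ∈ B, Φ y := fun r =>
    Finset.sum_equiv (T r) (fun y => (hT r y).symm) fun _ _ => rfl
  simp_rw [this]
  rw [Finset.sum_const, Finset.card_univ, nsmul_eq_mul, ← mul_assoc, inv_mul_cancel₀, one_mul]
  exact_mod_cast Fintype.card_ne_zero

lemma average_prod_eq_prod_average {ι R : Type*} [Fintype ι] [DecidableEq ι] [Fintype R]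
    (φ : ι → R → ℂ) :
    (Fintype.card (ι → R) : ℂ)⁻¹ * ∑ ρ : ι → R, ∏ i, φ i (ρ i) =
      ∏ i, ((Fintype.card R : ℂ)⁻¹ * ∑ r, φ i r) := by
  rw [Finset.prod_mul_distrib, Finset.prod_const, Finset.card_univ, Fintype.prod_sum]
  simp

end Symmetrization

section Ball

variable {d : ℕ}

/-- The lattice points in the closed Euclidean ball of radius `N`, as a finite set. -/
noncomputable def ballFin (d N : ℕ) : Finset (Fin d → ℤ) :=
  {y ∈ Fintype.piFinset fun _ => Finset.Icc (-(N : ℤ)) N | ∑ j, y j ^ 2 ≤ (N : ℤ) ^ 2}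

lemma mem_ballFin {N : ℕ} {y : Fin d → ℤ} : y ∈ ballFin d N ↔ ∑ j, y j ^ 2 ≤ (N : ℤ) ^ 2 := by
  simp only [ballFin, Finset.mem_filter, Fintype.mem_piFinset, Finset.mem_Icc, and_iff_right_iff_imp]
  intro h j
  have h1 : y j ^ 2 ≤ (N : ℤ) ^ 2 :=
    (Finset.single_le_sum (f := fun j => y j ^ 2) (fun i _ => sq_nonneg _) (Finset.mem_univ j)).trans h
  exact abs_le.mp (abs_le_of_sq_le_sq h1 (by positivity))

lemma zero_mem_ballFin (N : ℕ) : (0 : Fin d → ℤ) ∈ ballFin d N := by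
  rw [mem_ballFin]; simp

lemma card_ballFin_pos (d N : ℕ) : 0 < (ballFin d N).card :=
  Finset.card_pos.mpr ⟨0, zero_mem_ballFin N⟩

lemma sum_sq_coord_ballFin (N : ℕ) (j : Fin d) :
    (d : ℝ) * ∑ y ∈ ballFin d N, (y j : ℝ) ^ 2 ≤ (ballFin d N).card * (N : ℝ) ^ 2 := by
  have hsym : ∀ i, ∑ y ∈ ballFin d N, (y i : ℝ) ^ 2 = ∑ y ∈ ballFin d N, (y j : ℝ) ^ 2 := by
    intro i
    refine Finset.sum_equiv (Equiv.arrowCongr (Equiv.swap i j) (Equiv.refl ℤ)) (fun y => ?_)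
      fun y _ => ?_
    · simp only [mem_ballFin, Equiv.arrowCongr_apply, Function.comp, Equiv.refl_apply]
      rw [Equiv.sum_comp (Equiv.swap i j).symm fun k => y k ^ 2]
    · simp [Equiv.arrowCongr_apply]
  calc (d : ℝ) * ∑ y ∈ ballFin d N, (y j : ℝ) ^ 2
      = ∑ i : Fin d, ∑ y ∈ ballFin d N, (y i : ℝ) ^ 2 := by simp [hsym]
    _ = ∑ y ∈ ballFin d N, ∑ i : Fin d, (y i : ℝ) ^ 2 := Finset.sum_comm
    _ ≤ ∑ y ∈ ballFin d N, (N : ℝ) ^ 2 := Finset.sum_le_sum fun y hy => by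
        have := mem_ballFin.mp hy
        exact_mod_cast this
    _ = _ := by simp

/-- The Fourier multiplier of the average over the ball, as a function on `𝕋^d`. -/
noncomputable def ballMult (d N : ℕ) (z : Fin d → Circle) : ℂ :=
  ((ballFin d N).card : ℂ)⁻¹ * ∑ y ∈ ballFin d N, ∏ j, (z j : ℂ) ^ y j

/-- The average of the real parts of the coordinates. -/
noncomputable def meanRe (z : Fin d → Circle) : ℝ := (∑ j, (z j : ℂ).re) / d

lemma abs_re_circle_le (z : Circle) : |(z : ℂ).re| ≤ 1 := by
  exact (Complex.abs_re_le_norm _).trans (Circle.norm_coe z).le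

lemma abs_meanRe_le (z : Fin d → Circle) : |meanRe z| ≤ 1 := by
  rw [meanRe, abs_div, Nat.abs_cast]
  refine div_le_one_of_le₀ ?_ (Nat.cast_nonneg _)
  calc |∑ j, (z j : ℂ).re| ≤ ∑ j, |(z j : ℂ).re| := Finset.abs_sum_le_sum_abs _ _
    _ ≤ ∑ j : Fin d, 1 := Finset.sum_le_sum fun j _ => abs_re_circle_le _
    _ = d := by simp

lemma norm_ballMult_le_one (N : ℕ) (z : Fin d → Circle) : ‖ballMult d N z‖ ≤ 1 := by
  have hpos : (0 : ℝ) < (ballFin d N).card := by exact_mod_cast card_ballFin_pos d N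
  rw [ballMult, norm_mul, norm_inv, Complex.norm_natCast, inv_mul_le_iff₀ hpos, mul_one]
  refine (norm_sum_le _ _).trans ?_
  simp [norm_prod, norm_zpow, Circle.norm_coe]

lemma ballMult_eq_sum_re (N : ℕ) (z : Fin d → Circle) :
    ballMult d N z =
      (((ballFin d N).card : ℝ)⁻¹ * ∑ y ∈ ballFin d N, ∏ j, ((z j ^ y j : Circle) : ℂ).re : ℝ) := by
  rw [ballMult]
  push_cast
  congr 1
  rw [sum_eq_sum_average (ballFin d N)
    (fun ε : Fin d → ℤˣ => Equiv.piCongrRight fun j => (Units.mulLeft (ε j) : ℤ ≃ ℤ))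
    (fun ε y => by
      have hsq : ∀ u : ℤˣ, ((u : ℤ)) ^ 2 = 1 := fun u => by
        rcases Int.units_eq_one_or u with h | h <;> simp [h]
      simp [mem_ballFin, mul_pow, hsq])]
  refine Finset.sum_congr rfl fun y _ => ?_
  have h := average_prod_eq_prod_average (fun (j : Fin d) (u : ℤˣ) => (z j : ℂ) ^ ((u : ℤ) * y j))
  refine Eq.trans ?_ (h.trans ?_)
  · rfl
  refine Finset.prod_congr rfl fun j _ => ?_
  have hconj : (starRingEnd ℂ) ((z j : ℂ) ^ y j) = (z j : ℂ) ^ (-y j) := by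
    rw [map_zpow₀, ← Circle.coe_inv_eq_conj, Circle.coe_inv, inv_zpow, zpow_neg]
  rw [Complex.re_eq_add_conj, hconj]
  have hu : (Finset.univ : Finset ℤˣ) = {1, -1} := rfl
  rw [hu, Finset.sum_pair (by decide)]
  simp
  ring

lemma one_sub_re_zpow_le (z : Circle) (k : ℤ) :
    1 - ((z ^ k : Circle) : ℂ).re ≤ (k : ℝ) ^ 2 * (1 - (z : ℂ).re) := by
  have hsq : ∀ w : Circle, ‖(w : ℂ) - 1‖ ^ 2 = 2 * (1 - (w : ℂ).re) := fun w => by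
    have h1 := Circle.normSq_coe w
    rw [Complex.sq_norm, Complex.normSq_apply]
    rw [Complex.normSq_apply] at h1
    simp
    linarith
  have hnat : ∀ n : ℕ, ‖((z ^ n : Circle) : ℂ) - 1‖ ≤ n * ‖(z : ℂ) - 1‖ := fun n => by
    induction n with
    | zero => simp
    | succ n ih =>
      have : ((z ^ (n + 1) : Circle) : ℂ) - 1 =
          ((z ^ n : Circle) : ℂ) * ((z : ℂ) - 1) + (((z ^ n : Circle) : ℂ) - 1) := by
        rw [pow_succ]; push_cast; ring
      rw [this]
      refine (norm_add_le _ _).trans ?_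
      rw [norm_mul, Circle.norm_coe]
      rw [Nat.cast_succ]
      linarith
  have hint : ‖((z ^ k : Circle) : ℂ) - 1‖ ≤ |(k : ℝ)| * ‖(z : ℂ) - 1‖ := by
    obtain ⟨n, rfl | rfl⟩ := k.eq_nat_or_neg
    · simpa using hnat n
    · have h1 := hnat n
      have h2 : ‖((z ^ (-(n : ℤ)) : Circle) : ℂ) - 1‖ = ‖((z ^ n : Circle) : ℂ) - 1‖ := by
        rw [zpow_neg, zpow_natCast, Circle.coe_inv_eq_conj, ← Complex.norm_conj, map_sub,
          Complex.conj_conj, map_one]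
      rw [h2]
      simpa using h1
  have h := pow_le_pow_left₀ (norm_nonneg _) hint 2
  rw [mul_pow, hsq, hsq, sq_abs] at h
  linarith

lemma abs_prod_sub_one_le {ι : Type*} (s : Finset ι) (c : ι → ℝ) (hc : ∀ i, |c i| ≤ 1) :
    |∏ i ∈ s, c i - 1| ≤ ∑ i ∈ s, (1 - c i) := by
  classical
  induction s using Finset.induction_on with
  | empty => simp
  | insert a s ha ih =>
    rw [Finset.prod_insert ha, Finset.sum_insert ha]
    have : c a * ∏ i ∈ s, c i - 1 = c a * (∏ i ∈ s, c i - 1) - (1 - c a) := by ring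
    rw [this]
    refine (abs_sub _ _).trans ?_
    rw [abs_mul, abs_of_nonneg (by linarith [(abs_le.mp (hc a)).2] : 0 ≤ 1 - c a)]
    have := mul_le_mul_of_nonneg_right (hc a) (abs_nonneg (∏ i ∈ s, c i - 1))
    linarith

lemma sum_abs_prod_re_sub_one_le (hd : 1 ≤ d) (N : ℕ) (z : Fin d → Circle) :
    ∑ y ∈ ballFin d N, |∏ j, ((z j ^ y j : Circle) : ℂ).re - 1| ≤
      (ballFin d N).card * ((N : ℝ) ^ 2 * (1 - meanRe z)) := by
  have hd' : (0 : ℝ) < d := by exact_mod_cast hd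
  calc _ ≤ ∑ y ∈ ballFin d N, ∑ j, (y j : ℝ) ^ 2 * (1 - (z j : ℂ).re) :=
        Finset.sum_le_sum fun y _ => (abs_prod_sub_one_le _ _ fun _ => abs_re_circle_le _).trans
          (Finset.sum_le_sum fun j _ => one_sub_re_zpow_le _ _)
    _ = ∑ j, (∑ y ∈ ballFin d N, (y j : ℝ) ^ 2) * (1 - (z j : ℂ).re) := by
        rw [Finset.sum_comm]; simp_rw [Finset.sum_mul]
    _ ≤ ∑ j, ((ballFin d N).card * (N : ℝ) ^ 2 / d) * (1 - (z j : ℂ).re) :=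
        Finset.sum_le_sum fun j _ => mul_le_mul_of_nonneg_right
          (by rw [le_div_iff₀ hd', mul_comm]; exact sum_sq_coord_ballFin N j)
          (by linarith [(abs_le.mp (abs_re_circle_le (z j))).2])
    _ = _ := by
        rw [← Finset.mul_sum, Finset.sum_sub_distrib, meanRe]
        simp
        field_simp

/-- The multiplier of the operator which agrees with the identity on the even part of the ball
and with the nearest neighbour average on its odd part. -/
noncomputable def parityMult (d N : ℕ) (σ : ℝ) : ℝ :=
  ((ballFin d N).card : ℝ)⁻¹ * ∑ y ∈ ballFin d N, if Even (∑ j, y j) then 1 else σ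

lemma norm_ballMult_sub_parityMult_le_two (N : ℕ) (z : Fin d → Circle) :
    ‖ballMult d N z - parityMult d N (meanRe z)‖ ≤ 2 := by
  have hpos : (0 : ℝ) < (ballFin d N).card := by exact_mod_cast card_ballFin_pos d N
  refine (norm_sub_le _ _).trans ?_
  have h : ‖(parityMult d N (meanRe z) : ℂ)‖ ≤ 1 := by
    rw [Complex.norm_real, Real.norm_eq_abs, parityMult, abs_mul, abs_inv, Nat.abs_cast,
      inv_mul_le_iff₀ hpos, mul_one]
    refine (Finset.abs_sum_le_sum_abs _ _).trans ?_
    have : ∀ y ∈ ballFin d N, |(if Even (∑ j, y j) then 1 else meanRe z : ℝ)| ≤ 1 := fun y _ => by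
      split_ifs
      · simp
      · exact abs_meanRe_le z
    simpa using Finset.sum_le_sum this
  linarith [norm_ballMult_le_one N z]

lemma prod_re_neg_zpow (z : Fin d → Circle) (y : Fin d → ℤ) :
    ∏ j, ((z j ^ y j : Circle) : ℂ).re =
      (if Even (∑ j, y j) then 1 else -1) * ∏ j, (((-z j) ^ y j : Circle) : ℂ).re := by
  have h1 : ∀ j, (((-z j) ^ y j : Circle) : ℂ).re =
      (if Even (y j) then 1 else -1) * ((z j ^ y j : Circle) : ℂ).re := fun j => by
    split_ifs with h
    · rw [h.neg_zpow, one_mul]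
    · rw [(Int.not_even_iff_odd.mp h).neg_zpow]; simp
  have h2 : ∀ s : Finset (Fin d), ∏ j ∈ s, (if Even (y j) then (1 : ℝ) else -1) =
      if Even (∑ j ∈ s, y j) then 1 else -1 := fun s => by
    induction s using Finset.induction_on with
    | empty => simp
    | insert a s ha ih =>
      rw [Finset.prod_insert ha, Finset.sum_insert ha, ih]
      by_cases h3 : Even (y a) <;> by_cases h4 : Even (∑ j ∈ s, y j) <;>
        simp [h3, h4, Int.even_add]
  simp_rw [h1]
  rw [Finset.prod_mul_distrib, h2, ← mul_assoc]
  split_ifs <;> simp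

lemma meanRe_neg (z : Fin d → Circle) : meanRe (fun j => -z j) = -meanRe z := by
  simp [meanRe, neg_div]

lemma norm_ballMult_sub_parityMult_le (hd : 1 ≤ d) {N : ℕ} (hN : 1 ≤ N) (z : Fin d → Circle) :
    ‖ballMult d N z - parityMult d N (meanRe z)‖ ≤ 2 * (N : ℝ) ^ 2 * (1 - meanRe z ^ 2) := by
  have hpos : (0 : ℝ) < (ballFin d N).card := by exact_mod_cast card_ballFin_pos d N
  have hN' : (1 : ℝ) ≤ (N : ℝ) ^ 2 := one_le_pow₀ (by exact_mod_cast hN)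
  have hσ := abs_le.mp (abs_meanRe_le z)
  rw [ballMult_eq_sum_re, parityMult, ← Complex.ofReal_sub, Complex.norm_real, Real.norm_eq_abs,
    ← mul_sub, ← Finset.sum_sub_distrib, abs_mul, abs_inv, Nat.abs_cast, inv_mul_le_iff₀ hpos]
  refine (Finset.abs_sum_le_sum_abs _ _).trans ?_
  rcases le_total 0 (meanRe z) with h0 | h0
  · calc _ ≤ ∑ y ∈ ballFin d N, (|∏ j, ((z j ^ y j : Circle) : ℂ).re - 1| + (1 - meanRe z)) :=
          Finset.sum_le_sum fun y _ => by
            split_ifs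
            · linarith
            · rw [← abs_of_nonneg (by linarith : 0 ≤ 1 - meanRe z)]
              refine le_trans (le_of_eq ?_) (abs_add_le _ _)
              congr 1; ring
      _ ≤ (ballFin d N).card * ((N : ℝ) ^ 2 * (1 - meanRe z)) +
          (ballFin d N).card * (1 - meanRe z) := by
            rw [Finset.sum_add_distrib]
            gcongr
            · exact sum_abs_prod_re_sub_one_le hd N z
            · exact le_of_eq (by simp; ring)
      _ ≤ _ := by
            rw [← mul_add]
            gcongr
            nlinarith [mul_nonneg h0 (by linarith : 0 ≤ 1 - meanRe z)]
  · have hneg := sum_abs_prod_re_sub_one_le hd N fun j => -z j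
    rw [meanRe_neg] at hneg
    calc _ ≤ ∑ y ∈ ballFin d N,
          (|∏ j, (((-z j) ^ y j : Circle) : ℂ).re - 1| + (1 + meanRe z)) :=
          Finset.sum_le_sum fun y _ => by
            rw [prod_re_neg_zpow]
            split_ifs
            · rw [one_mul]; linarith
            · rw [← abs_of_nonneg (by linarith : 0 ≤ 1 + meanRe z), ← abs_neg (_ - meanRe z)]
              refine le_trans (le_of_eq ?_) (abs_add_le _ _)
              congr 1; ring
      _ ≤ (ballFin d N).card * ((N : ℝ) ^ 2 * (1 - -meanRe z)) +
          (ballFin d N).card * (1 + meanRe z) := by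
            rw [Finset.sum_add_distrib]
            gcongr
            exact le_of_eq (by simp; ring)
      _ ≤ _ := by
            rw [← mul_add]
            gcongr
            nlinarith [mul_nonneg (by linarith : 0 ≤ -meanRe z) (by linarith : 0 ≤ 1 + meanRe z)]

end Ball

section PermAverage

lemma sum_prod_pair {α κ : Type*} [Fintype α] [Fintype κ] [DecidableEq κ] (φ : α → α → ℝ) :
    ∑ g : κ × Bool → α, ∏ p, φ (g (p, false)) (g (p, true)) =
      (∑ i, ∑ j, φ i j) ^ Fintype.card κ := by
  have h : ∑ i, ∑ j, φ i j = ∑ v : Bool → α, φ (v false) (v true) := by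
    rw [← Fintype.sum_prod_type']
    exact Fintype.sum_equiv (Equiv.boolArrowEquivProd α).symm _ _ fun v => rfl
  rw [h, ← Finset.card_univ, ← Finset.prod_const, Fintype.prod_sum]
  exact Fintype.sum_equiv (Equiv.curry κ Bool α) _ _ fun g => rfl

variable {α : Type*} [Fintype α] [DecidableEq α]

/-- In a sum over all permutations, the values at disjoint transposed positions may be averaged. -/
lemma sum_perm_prod_eq_sum_perm_prod_average (u : α → ℝ) (b : α → α) (S : Finset α)
    (hinj : Set.InjOn b S) (hb : ∀ j ∈ S, b j ∉ S) (R : Equiv.Perm α → ℝ)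
    (hR : ∀ j ∈ S, ∀ σ, R (σ * Equiv.swap j (b j)) = R σ) :
    ∑ σ : Equiv.Perm α, (∏ j ∈ S, u (σ j)) * R σ =
      ∑ σ : Equiv.Perm α, (∏ j ∈ S, (u (σ j) + u (σ (b j))) / 2) * R σ := by
  induction S using Finset.induction_on generalizing R with
  | empty => simp
  | insert a S ha ih =>
    have hba : b a ∉ insert a S := hb a (Finset.mem_insert_self a S)
    have hfix : ∀ j ∈ S, Equiv.swap a (b a) j = j := fun j hj =>
      Equiv.swap_apply_of_ne_of_ne (fun h => ha (h ▸ hj))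
        (fun h => hba (Finset.mem_insert_of_mem (h ▸ hj)))
    have hswap : ∑ σ : Equiv.Perm α, (∏ j ∈ insert a S, u (σ j)) * R σ =
        ∑ σ : Equiv.Perm α, u (σ (b a)) * (∏ j ∈ S, u (σ j)) * R σ := by
      rw [← Equiv.sum_comp (Equiv.mulRight (Equiv.swap a (b a)))]
      refine Finset.sum_congr rfl fun σ _ => ?_
      rw [Equiv.coe_mulRight, hR a (Finset.mem_insert_self a S), Finset.prod_insert ha,
        Equiv.Perm.mul_apply, Equiv.swap_apply_left]
      congr 2
      exact Finset.prod_congr rfl fun j hj => by rw [Equiv.Perm.mul_apply, hfix j hj]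
    have hhalf : ∑ σ : Equiv.Perm α, (∏ j ∈ insert a S, u (σ j)) * R σ =
        ∑ σ : Equiv.Perm α, (∏ j ∈ S, u (σ j)) * ((u (σ a) + u (σ (b a))) / 2 * R σ) := by
      have h2 : ∑ σ : Equiv.Perm α, (∏ j ∈ insert a S, u (σ j)) * R σ =
          (∑ σ : Equiv.Perm α, (∏ j ∈ insert a S, u (σ j)) * R σ +
            ∑ σ : Equiv.Perm α, u (σ (b a)) * (∏ j ∈ S, u (σ j)) * R σ) / 2 := by
        rw [← hswap]; ring
      rw [h2, ← Finset.sum_add_distrib, Finset.sum_div]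
      refine Finset.sum_congr rfl fun σ _ => ?_
      rw [Finset.prod_insert ha]
      ring
    rw [hhalf, ih (hinj.mono (by simp)) (fun j hj h => hb j (Finset.mem_insert_of_mem hj)
      (Finset.mem_insert_of_mem h))]
    · refine Finset.sum_congr rfl fun σ _ => ?_
      rw [Finset.prod_insert ha]
      ring
    · intro j hj σ
      have hj' := Finset.mem_insert_of_mem (b := a) hj
      have haj : a ≠ j := fun h => ha (h ▸ hj)
      have h1 : Equiv.swap j (b j) a = a := Equiv.swap_apply_of_ne_of_ne haj
        (fun h => hb j hj' (h ▸ Finset.mem_insert_self a S))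
      have h2 : Equiv.swap j (b j) (b a) = b a := Equiv.swap_apply_of_ne_of_ne
        (fun h => hba (h ▸ hj'))
        (fun h => haj (hinj (Finset.mem_coe.mpr (Finset.mem_insert_self a S))
          (Finset.mem_coe.mpr hj') h))
      simp only [Equiv.Perm.mul_apply, h1, h2, hR j hj']

lemma descFactorial_mul_sum_perm {ι : Type*} [Fintype ι] [DecidableEq ι] (e : ι → α)
    (he : Function.Injective e) (F : (ι → α) → ℝ) :
    ((Fintype.card α).descFactorial (Fintype.card ι) : ℝ) * ∑ σ : Equiv.Perm α, F (σ ∘ e) =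
      (Fintype.card α).factorial * ∑ g : ι → α with Function.Injective g, F g := by
  have hindep : ∀ g : ι → α, Function.Injective g →
      ∑ σ : Equiv.Perm α, F (σ ∘ g) = ∑ σ : Equiv.Perm α, F (σ ∘ e) := by
    intro g hg
    obtain ⟨ρ, hρ⟩ : ∃ ρ : Equiv.Perm α, ∀ i, ρ (e i) = g i := by
      let E := (Equiv.ofInjective e he).symm.trans (Equiv.ofInjective g hg)
      refine ⟨E.extendSubtype, fun i => ?_⟩
      rw [Equiv.extendSubtype_apply_of_mem _ _ ⟨i, rfl⟩]
      have : (⟨e i, ⟨i, rfl⟩⟩ : Set.range e) = Equiv.ofInjective e he i := rfl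
      rw [Equiv.trans_apply, this, Equiv.symm_apply_apply, Equiv.ofInjective_apply]
    rw [← Equiv.sum_comp (Equiv.mulRight ρ) fun σ => F (σ ∘ e)]
    refine Finset.sum_congr rfl fun σ _ => congrArg F (funext fun i => ?_)
    simp [hρ]
  have hcard : (Finset.univ.filter fun g : ι → α => Function.Injective g).card =
      (Fintype.card α).descFactorial (Fintype.card ι) := by
    rw [← Fintype.card_embedding_eq, ← Fintype.card_subtype]
    exact Fintype.card_congr (Equiv.subtypeInjectiveEquivEmbedding ι α)
  calc _ = ∑ g : ι → α with Function.Injective g, ∑ σ : Equiv.Perm α, F (σ ∘ g) := by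
        rw [Finset.sum_congr rfl fun g hg => hindep g (Finset.mem_filter.mp hg).2,
          Finset.sum_const, hcard, nsmul_eq_mul]
    _ = ∑ σ : Equiv.Perm α, ∑ g : ι → α with Function.Injective g, F (σ ∘ g) := Finset.sum_comm
    _ = ∑ σ : Equiv.Perm α, ∑ g : ι → α with Function.Injective g, F g := by
        refine Finset.sum_congr rfl fun σ _ => ?_
        refine Finset.sum_equiv (Equiv.arrowCongr (Equiv.refl ι) σ) (fun g => ?_) fun g _ => ?_
        · simp [Equiv.arrowCongr]
        · rfl
    _ = _ := by rw [Finset.sum_const, Finset.card_univ, Fintype.card_perm, nsmul_eq_mul]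

lemma sum_perm_pair (φ : α → α → ℝ) (hφ : ∀ i, φ i i = 0) {a b : α} (hab : a ≠ b) :
    (Fintype.card α * (Fintype.card α - 1) : ℝ) * ∑ σ : Equiv.Perm α, φ (σ a) (σ b) =
      (Fintype.card α).factorial * ∑ i, ∑ j, φ i j := by
  have h := descFactorial_mul_sum_perm (fun p : Unit × Bool => if p.2 then b else a)
    (fun p q hpq => by
      rcases p with ⟨_, _ | _⟩ <;> rcases q with ⟨_, _ | _⟩ <;> simp_all [hab.symm])
    fun g => ∏ p, φ (g (p, false)) (g (p, true))
  have hc : ((Fintype.card α).descFactorial (Fintype.card (Unit × Bool)) : ℝ) =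
      Fintype.card α * (Fintype.card α - 1) := by
    simpa using Nat.cast_descFactorial_two ℝ (Fintype.card α)
  rw [hc, Finset.sum_filter_of_ne, sum_prod_pair] at h
  · simpa using h
  · rintro g - hg ⟨_, p⟩ ⟨_, q⟩ hpq
    by_contra hne
    apply hg
    cases p <;> cases q <;> simp_all

lemma sum_perm_pair_mul_pair_le (φ : α → α → ℝ) (hφ : ∀ i j, 0 ≤ φ i j) {a b a' b' : α}
    (h : [a, b, a', b'].Nodup) :
    ((Fintype.card α).descFactorial 4 : ℝ) *
        ∑ σ : Equiv.Perm α, φ (σ a) (σ b) * φ (σ a') (σ b') ≤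
      (Fintype.card α).factorial * (∑ i, ∑ j, φ i j) ^ 2 := by
  have h1 := descFactorial_mul_sum_perm
    (fun p : Bool × Bool => if p.1 then (if p.2 then b else a) else if p.2 then b' else a')
    (fun p q hpq => by
      simp only [List.nodup_cons, List.mem_cons, not_or] at h
      rcases p with ⟨_ | _, _ | _⟩ <;> rcases q with ⟨_ | _, _ | _⟩ <;> simp_all [eq_comm])
    fun g => ∏ p, φ (g (p, false)) (g (p, true))
  have h2 := sum_prod_pair (κ := Bool) φ
  have h3 : Fintype.card (Bool × Bool) = 4 := rfl
  rw [h3] at h1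
  simp only [Fintype.prod_bool, Function.comp, if_true, Bool.false_eq_true, if_false,
    Fintype.card_bool] at h1 h2
  rw [h1, ← h2]
  refine mul_le_mul_of_nonneg_left ?_ (Nat.cast_nonneg _)
  exact Finset.sum_le_sum_of_subset_of_nonneg (Finset.filter_subset _ _)
    fun g _ _ => mul_nonneg (hφ _ _) (hφ _ _)

lemma exp_neg_le_of_pos {t Y : ℝ} (ht : 0 < t) (hY : 0 ≤ Y) :
    Real.exp (-Y) ≤ 2 / t + 4 * (Y - t) ^ 2 / t ^ 2 := by
  rcases le_total (t / 2) Y with h | h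
  · have h1 : Real.exp (-Y) ≤ 2 / t := by
      rw [Real.exp_neg, inv_le_comm₀ (Real.exp_pos _) (by positivity), inv_div]
      linarith [Real.add_one_le_exp Y]
    have : 0 ≤ 4 * (Y - t) ^ 2 / t ^ 2 := by positivity
    linarith
  · have h1 : 1 ≤ 4 * (Y - t) ^ 2 / t ^ 2 := by
      rw [le_div_iff₀ (by positivity)]
      nlinarith
    have h2 : Real.exp (-Y) ≤ 1 := Real.exp_le_one_iff.mpr (by linarith)
    have : 0 ≤ 2 / t := by positivity
    linarith

/-- Variance bound for the sum of a nonnegative kernel over randomly placed disjoint pairs. -/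
lemma sum_perm_sub_sq_le (φ : α → α → ℝ) (hφ0 : ∀ i, φ i i = 0) (hφ : ∀ i j, 0 ≤ φ i j)
    (hφ1 : ∀ i j, φ i j ≤ 1) (b : α → α) (S : Finset α)
    (hinj : Set.InjOn b S) (hb : ∀ j ∈ S, b j ∉ S) (hS : 1 ≤ S.card)
    (hcard : 200 * S.card ≤ Fintype.card α) {μ : ℝ}
    (hμ : (Fintype.card α * (Fintype.card α - 1) : ℝ) * μ = ∑ i, ∑ j, φ i j) :
    ∑ σ : Equiv.Perm α, (∑ p ∈ S, φ (σ p) (σ (b p)) - S.card * μ) ^ 2 ≤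
      (Fintype.card α).factorial * (2 * (S.card * μ)) := by
  set D : ℝ := (Fintype.card α : ℝ) with hD
  set s : ℝ := (S.card : ℝ) with hs
  set P : ℝ := ((Fintype.card α).factorial : ℝ) with hP
  have hs1 : 1 ≤ s := by rw [hs]; exact_mod_cast hS
  have hDs : 200 * s ≤ D := by rw [hs, hD]; exact_mod_cast hcard
  have hPpos : 0 < P := Nat.cast_pos.mpr (Nat.factorial_pos _)
  have hDD : 0 < D * (D - 1) := by nlinarith
  have hne : ∀ p ∈ S, p ≠ b p := fun p hp h => hb p hp (h ▸ hp)
  have hmean : ∀ p ∈ S, ∑ σ : Equiv.Perm α, φ (σ p) (σ (b p)) = P * μ := fun p hp => by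
    have := sum_perm_pair φ hφ0 (hne p hp)
    rw [← hμ] at this
    apply mul_left_cancel₀ hDD.ne'
    rw [this]; ring
  obtain ⟨p₀, hp₀⟩ := Finset.card_pos.mp hS
  have hμ0 : 0 ≤ μ := by
    have := hmean p₀ hp₀
    have h0 : 0 ≤ P * μ := this ▸ Finset.sum_nonneg fun _ _ => hφ _ _
    exact nonneg_of_mul_nonneg_right h0 hPpos
  have hμ1 : μ ≤ 1 := by
    have h0 : P * μ ≤ P * 1 := by
      rw [← hmean p₀ hp₀]
      refine (Finset.sum_le_sum fun σ _ => hφ1 _ _).trans ?_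
      simp [hP, Fintype.card_perm]
    exact le_of_mul_le_mul_left h0 hPpos
  have hdf : ((Fintype.card α).descFactorial 4 : ℝ) = D * (D - 1) * (D - 2) * (D - 3) := by
    have h4 : 4 ≤ Fintype.card α := by omega
    simp only [Nat.descFactorial_succ, Nat.descFactorial_zero, Nat.sub_zero]
    push_cast [Nat.cast_sub (show 3 ≤ Fintype.card α by omega),
      Nat.cast_sub (show 2 ≤ Fintype.card α by omega),
      Nat.cast_sub (show 1 ≤ Fintype.card α by omega)]
    ring
  have hoff : ∀ p ∈ S, ∀ q ∈ S, p ≠ q →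
      ∑ σ : Equiv.Perm α, φ (σ p) (σ (b p)) * φ (σ q) (σ (b q)) ≤
        P * μ ^ 2 * (1 + 6 / D) := by
    intro p hp q hq hpq
    have hnd : [p, b p, q, b q].Nodup := by
      have h1 : b p ≠ b q := fun h => hpq (hinj hp hq h)
      have h2 : p ≠ b q := fun h => hb q hq (h ▸ hp)
      have h3 : b p ≠ q := fun h => hb p hp (h ▸ hq)
      simp [hpq, h1, h2, h3, hne p hp, hne q hq]
    have h := sum_perm_pair_mul_pair_le φ hφ hnd
    rw [hdf, ← hμ] at h
    have hpos : 0 < D * (D - 1) * (D - 2) * (D - 3) := by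
      have : 0 < D - 2 := by linarith
      have : 0 < D - 3 := by linarith
      positivity
    refine le_of_mul_le_mul_left (h.trans ?_) hpos
    have hkey : D * (D - 1) ≤ (D - 2) * (D - 3) * (1 + 6 / D) := by
      have hDpos : 0 < D := by linarith
      have : (D - 2) * (D - 3) * (1 + 6 / D) - D * (D - 1) = (2 * D ^ 2 - 24 * D + 36) / D := by
        field_simp
        ring
      have h0 : 0 ≤ (2 * D ^ 2 - 24 * D + 36) / D := div_nonneg (by nlinarith) hDpos.le
      linarith
    calc P * (D * (D - 1) * μ) ^ 2 = P * μ ^ 2 * (D * (D - 1)) * (D * (D - 1)) := by ring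
      _ ≤ P * μ ^ 2 * (D * (D - 1)) * ((D - 2) * (D - 3) * (1 + 6 / D)) := by gcongr
      _ = _ := by ring
  have hsq : ∑ σ : Equiv.Perm α, (∑ p ∈ S, φ (σ p) (σ (b p))) ^ 2 ≤
      s * (P * μ) + s ^ 2 * (P * μ ^ 2 * (1 + 6 / D)) := by
    have hM : 0 ≤ P * μ ^ 2 * (1 + 6 / D) := by
      have : 0 ≤ D := by linarith
      positivity
    calc _ = ∑ p ∈ S, ∑ q ∈ S, ∑ σ : Equiv.Perm α, φ (σ p) (σ (b p)) * φ (σ q) (σ (b q)) := by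
          simp_rw [sq, Finset.sum_mul_sum]
          rw [Finset.sum_comm]
          exact Finset.sum_congr rfl fun p _ => Finset.sum_comm
      _ ≤ ∑ p ∈ S, ∑ q ∈ S, ((if p = q then P * μ else 0) + P * μ ^ 2 * (1 + 6 / D)) := by
          refine Finset.sum_le_sum fun p hp => Finset.sum_le_sum fun q hq => ?_
          split_ifs with hpq
          · subst hpq
            rw [← hmean p hp]
            refine le_add_of_le_of_nonneg (Finset.sum_le_sum fun σ _ => ?_) hM
            exact mul_le_of_le_one_right (hφ _ _) (hφ1 _ _)
          · rw [zero_add]; exact hoff p hp q hq hpq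
      _ = _ := by
          simp_rw [Finset.sum_add_distrib, Finset.sum_ite_eq]
          simp [← hs]
          ring
  have hexp : ∑ σ : Equiv.Perm α, (∑ p ∈ S, φ (σ p) (σ (b p)) - s * μ) ^ 2 =
      ∑ σ : Equiv.Perm α, (∑ p ∈ S, φ (σ p) (σ (b p))) ^ 2 - P * (s * μ) ^ 2 := by
    have h1 : ∑ σ : Equiv.Perm α, ∑ p ∈ S, φ (σ p) (σ (b p)) = s * (P * μ) := by
      rw [Finset.sum_comm, Finset.sum_congr rfl hmean]; simp [hs]
    simp_rw [sub_sq]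
    rw [Finset.sum_add_distrib, Finset.sum_sub_distrib]
    simp_rw [mul_assoc, ← Finset.mul_sum, ← Finset.sum_mul]
    rw [h1]
    simp [Fintype.card_perm, ← hP]
    ring
  rw [hexp]
  have h6 : s ^ 2 * (6 / D) ≤ s := by
    rw [mul_div_assoc', div_le_iff₀ (by linarith)]
    nlinarith
  have h7 : P * μ ^ 2 * (s ^ 2 * (6 / D)) ≤ P * μ * s :=
    mul_le_mul (by nlinarith [mul_nonneg hPpos.le (mul_nonneg hμ0 (sub_nonneg.mpr hμ1))]) h6 (by positivity) (by positivity)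
  nlinarith

lemma sum_perm_prod_pair_le (β : α → α → ℝ) (hβ : ∀ i j, 0 ≤ β i j)
    (hβ1 : ∀ i j, β i j ≤ 1) (b : α → α) (S : Finset α)
    (hinj : Set.InjOn b S) (hb : ∀ j ∈ S, b j ∉ S) (hS : 1 ≤ S.card)
    (hcard : 200 * S.card ≤ Fintype.card α) :
    (∑ i, ∑ j, if i = j then 0 else 1 - β i j) * S.card *
        ∑ σ : Equiv.Perm α, ∏ p ∈ S, β (σ p) (σ (b p)) ≤
      10 * (Fintype.card α : ℝ) ^ 2 * (Fintype.card α).factorial := by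
  set φ : α → α → ℝ := fun i j => if i = j then 0 else 1 - β i j with hφdef
  have hφ : ∀ i j, 0 ≤ φ i j := fun i j => by
    simp only [hφdef]; split_ifs
    · rfl
    · linarith [hβ1 i j]
  have hφ1 : ∀ i j, φ i j ≤ 1 := fun i j => by
    simp only [hφdef]; split_ifs
    · exact zero_le_one
    · linarith [hβ i j]
  set D : ℝ := (Fintype.card α : ℝ) with hD
  set s : ℝ := (S.card : ℝ) with hs
  set P : ℝ := ((Fintype.card α).factorial : ℝ) with hP
  have hs1 : 1 ≤ s := by rw [hs]; exact_mod_cast hS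
  have hDs : 200 * s ≤ D := by rw [hs, hD]; exact_mod_cast hcard
  have hPpos : 0 < P := Nat.cast_pos.mpr (Nat.factorial_pos _)
  have hDD : 0 < D * (D - 1) := by nlinarith
  set Q := ∑ i, ∑ j, φ i j with hQ
  have hQ0 : 0 ≤ Q := Finset.sum_nonneg fun i _ => Finset.sum_nonneg fun j _ => hφ i j
  rcases hQ0.eq_or_lt with h0 | hQpos
  · rw [← h0]; simp; positivity
  set μ := Q / (D * (D - 1)) with hμdef
  have hμ : D * (D - 1) * μ = Q := mul_div_cancel₀ _ hDD.ne'
  have hμpos : 0 < μ := div_pos hQpos hDD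
  have hvar := sum_perm_sub_sq_le φ (fun i => by simp [hφdef]) hφ hφ1 b S hinj hb hS hcard hμ
  rw [← hs, ← hP] at hvar
  set t := s * μ with ht
  have htpos : 0 < t := by positivity
  have hsum : ∑ σ : Equiv.Perm α, ∏ p ∈ S, β (σ p) (σ (b p)) ≤ 10 * P / t := by
    calc _ ≤ ∑ σ : Equiv.Perm α, (2 / t + 4 * (∑ p ∈ S, φ (σ p) (σ (b p)) - t) ^ 2 / t ^ 2) := by
          refine Finset.sum_le_sum fun σ _ => ?_
          refine le_trans ?_ (exp_neg_le_of_pos htpos (Finset.sum_nonneg fun p _ => hφ _ _))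
          rw [← Finset.sum_neg_distrib, Real.exp_sum]
          refine Finset.prod_le_prod (fun p _ => hβ _ _) fun p hp => ?_
          have hne : σ p ≠ σ (b p) := fun h => hb p hp ((σ.injective h) ▸ hp)
          have h2 : β (σ p) (σ (b p)) = 1 - φ (σ p) (σ (b p)) := by simp [hφdef, hne]
          rw [h2]
          exact Real.one_sub_le_exp_neg _
      _ = P * (2 / t) + 4 / t ^ 2 *
            ∑ σ : Equiv.Perm α, (∑ p ∈ S, φ (σ p) (σ (b p)) - t) ^ 2 := by
          rw [Finset.sum_add_distrib, Finset.mul_sum]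
          simp only [Finset.sum_const, Finset.card_univ, Fintype.card_perm, nsmul_eq_mul]
          congr 1
          exact Finset.sum_congr rfl fun _ _ => by ring
      _ ≤ P * (2 / t) + 4 / t ^ 2 * (P * (2 * t)) := by gcongr
      _ = _ := by field_simp; ring
  calc Q * s * _ ≤ Q * s * (10 * P / t) := by gcongr
    _ = 10 * (D * (D - 1)) * P := by
      rw [ht, hμdef]; field_simp
    _ ≤ 10 * D ^ 2 * P := by
      have : D * (D - 1) ≤ D ^ 2 := by nlinarith
      gcongr

end PermAverage

section Decay

variable {d : ℕ}

/-- The coordinates at which a lattice point takes one of the values `1`, `-1`. -/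
def unitCoords (y : Fin d → ℤ) : Finset (Fin d) := {j | (y j).natAbs = 1}

lemma sum_pair_average_ge (hd : 2 ≤ d) (c : Fin d → ℝ) (hc : ∀ i, |c i| ≤ 1) :
    ((d : ℝ) ^ 2 - (∑ i, c i) ^ 2) / 4 ≤
      ∑ i, ∑ j, if i = j then 0 else 1 - |c i + c j| / 2 := by
  have hd' : (2 : ℝ) ≤ d := by exact_mod_cast hd
  have hle : ∀ i j, (1 - ((c i + c j) / 2) ^ 2) / 2 - (if i = j then (1 - c i ^ 2) / 2 else 0) ≤
      if i = j then 0 else 1 - |c i + c j| / 2 := fun i j => by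
    split_ifs with h
    · subst h; exact le_of_eq (by ring)
    · have h1 : |c i + c j| ≤ 2 := (abs_add_le _ _).trans (by linarith [hc i, hc j])
      have h2 : |c i + c j| ^ 2 = (c i + c j) ^ 2 := sq_abs _
      nlinarith [sq_nonneg (|c i + c j| - 2)]
  refine le_trans ?_ (Finset.sum_le_sum fun i _ => Finset.sum_le_sum fun j _ => hle i j)
  have hQ : ∑ i, c i ^ 2 ≤ d := by
    refine (Finset.sum_le_sum fun i _ => ?_).trans (by simp : ∑ _i : Fin d, (1 : ℝ) ≤ d)
    exact (sq_le_one_iff_abs_le_one _).mpr (hc i)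
  have hsum : ∑ i, ∑ j, ((1 - ((c i + c j) / 2) ^ 2) / 2 -
      (if i = j then (1 - c i ^ 2) / 2 else 0)) =
      (d : ℝ) ^ 2 / 2 - (2 * d * ∑ i, c i ^ 2 + 2 * (∑ i, c i) ^ 2) / 8 -
        (d - ∑ i, c i ^ 2) / 2 := by
    have h1 : ∀ i j, (1 - ((c i + c j) / 2) ^ 2) / 2 =
        1 / 2 - (c i ^ 2 / 8 + (c i / 4) * c j + c j ^ 2 / 8) := fun i j => by ring
    simp_rw [Finset.sum_sub_distrib, h1, Finset.sum_sub_distrib, Finset.sum_add_distrib,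
      Finset.sum_ite_eq, ← Finset.mul_sum, ← Finset.sum_mul, ← Finset.sum_div]
    simp only [Finset.mem_univ, if_true, Finset.sum_const, Finset.card_univ, Fintype.card_fin,
      nsmul_eq_mul, ← Finset.mul_sum, ← Finset.sum_div, Finset.sum_sub_distrib]
    ring
  rw [hsum]
  nlinarith [mul_nonneg (by linarith : 0 ≤ (d : ℝ) - 2) (by linarith : 0 ≤ d - ∑ i, c i ^ 2)]

lemma card_support_le {N : ℕ} {y : Fin d → ℤ} (hy : y ∈ ballFin d N) :
    (Finset.univ.filter fun j => y j ≠ 0).card ≤ N ^ 2 := by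
  have h : ((Finset.univ.filter fun j => y j ≠ 0).card : ℤ) ≤ ∑ j, y j ^ 2 := by
    rw [Finset.card_filter]
    push_cast
    refine Finset.sum_le_sum fun j _ => ?_
    split_ifs with h
    · exact Int.one_le_abs h |>.trans (by rw [← sq_abs]; nlinarith [Int.one_le_abs h])
    · positivity
  exact_mod_cast h.trans (mem_ballFin.mp hy)

lemma unitCoords_subset (y : Fin d → ℤ) :
    unitCoords y ⊆ Finset.univ.filter fun j => y j ≠ 0 := fun j hj => by
  simp only [unitCoords, Finset.mem_filter, Finset.mem_univ, true_and] at hj ⊢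
  rintro h
  simp [h] at hj

lemma exists_partner {N : ℕ} (hN : 200 * N ^ 2 ≤ d) {y : Fin d → ℤ} (hy : y ∈ ballFin d N) :
    ∃ b : Fin d → Fin d, Set.InjOn b (unitCoords y) ∧ ∀ j ∈ unitCoords y, y (b j) = 0 := by
  have hle : (unitCoords y).card ≤ (Finset.univ.filter fun j => y j = 0).card := by
    have h1 := card_support_le hy
    have h2 := Finset.card_le_card (unitCoords_subset y)
    have h3 := Finset.card_filter_add_card_filter_not (s := Finset.univ) fun j => y j = 0
    rw [Finset.card_univ, Fintype.card_fin] at h3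
    have h4 : (Finset.univ.filter fun j => ¬ y j = 0).card =
      (Finset.univ.filter fun j => y j ≠ 0).card := rfl
    omega
  rw [← Fintype.card_coe, ← Fintype.card_coe] at hle
  obtain ⟨e⟩ := Function.Embedding.nonempty_of_card_le hle
  refine ⟨fun j => if h : j ∈ unitCoords y then e ⟨j, h⟩ else j, fun i hi j hj hij => ?_,
    fun j hj => ?_⟩
  · rw [Finset.mem_coe] at hi hj
    simp only [hi, hj, dif_pos] at hij
    simpa using e.injective (Subtype.ext hij)
  · simp only [hj, dif_pos]
    exact (Finset.mem_filter.mp (e ⟨j, hj⟩).2).2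

lemma abs_sum_perm_prod_re_le {N : ℕ} (hd : 2 ≤ d) (hN : 200 * N ^ 2 ≤ d) {y : Fin d → ℤ}
    (hy : y ∈ ballFin d N) (z : Fin d → Circle) :
    (unitCoords y).card * (1 - meanRe z ^ 2) *
        |∑ σ : Equiv.Perm (Fin d), ∏ j, ((z (σ j) ^ y j : Circle) : ℂ).re| ≤
      40 * d.factorial := by
  have hd' : (2 : ℝ) ≤ d := by exact_mod_cast hd
  rcases Nat.eq_zero_or_pos (unitCoords y).card with hs | hs
  · rw [hs]; simp
  obtain ⟨b, hinj, hb0⟩ := exists_partner hN hy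
  set S := unitCoords y with hS
  have hb : ∀ j ∈ S, b j ∉ S := fun j hj h => by
    simp [hS, unitCoords, hb0 j hj] at h
  set c : Fin d → ℝ := fun i => (z i : ℂ).re with hc
  have hc1 : ∀ i, |c i| ≤ 1 := fun i => abs_re_circle_le _
  set R : Equiv.Perm (Fin d) → ℝ := fun σ => ∏ j ∈ Sᶜ, ((z (σ j) ^ y j : Circle) : ℂ).re with hR
  have hRle : ∀ σ, |R σ| ≤ 1 := fun σ => by
    rw [hR, Finset.abs_prod]
    exact Finset.prod_le_one (fun _ _ => abs_nonneg _) fun _ _ => abs_re_circle_le _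
  have hsplit : ∀ σ : Equiv.Perm (Fin d), ∏ j, ((z (σ j) ^ y j : Circle) : ℂ).re =
      (∏ j ∈ S, c (σ j)) * R σ := fun σ => by
    rw [← Finset.prod_mul_prod_compl S]
    congr 1
    refine Finset.prod_congr rfl fun j hj => ?_
    have hj1 : (y j).natAbs = 1 := (Finset.mem_filter.mp hj).2
    rcases Int.natAbs_eq_iff.mp hj1 with h | h
    · simp [h, hc]
    · rw [h, Nat.cast_one, zpow_neg_one, Circle.coe_inv_eq_conj, Complex.conj_re]
  have hRswap : ∀ j ∈ S, ∀ σ, R (σ * Equiv.swap j (b j)) = R σ := fun j hj σ => by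
    refine Finset.prod_congr rfl fun i hi => ?_
    rw [Finset.mem_compl] at hi
    by_cases hib : i = b j
    · rw [hib, hb0 j hj]; simp
    · have hij : i ≠ j := fun h => hi (h ▸ hj)
      rw [Equiv.Perm.mul_apply, Equiv.swap_apply_of_ne_of_ne hij hib]
  have hcard : 200 * S.card ≤ Fintype.card (Fin d) := by
    rw [Fintype.card_fin]
    exact (Nat.mul_le_mul_left _ ((Finset.card_le_card (unitCoords_subset y)).trans
      (card_support_le hy))).trans hN
  have hmain := sum_perm_prod_pair_le (fun i j => |c i + c j| / 2) (fun i j => by positivity)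
    (fun i j => by
      have := abs_add_le (c i) (c j)
      linarith [hc1 i, hc1 j]) b S hinj hb hs hcard
  rw [Fintype.card_fin] at hmain
  have hpair := sum_pair_average_ge hd c hc1
  have hA : ∑ i, c i = d * meanRe z := by
    rw [meanRe, mul_div_cancel₀ _ (by positivity)]
  rw [hA] at hpair
  have habs : |∑ σ : Equiv.Perm (Fin d), ∏ j, ((z (σ j) ^ y j : Circle) : ℂ).re| ≤
      ∑ σ : Equiv.Perm (Fin d), ∏ p ∈ S, |c (σ p) + c (σ (b p))| / 2 := by
    simp_rw [hsplit]
    rw [sum_perm_prod_eq_sum_perm_prod_average c b S hinj hb R hRswap]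
    refine (Finset.abs_sum_le_sum_abs _ _).trans (Finset.sum_le_sum fun σ _ => ?_)
    rw [abs_mul, Finset.abs_prod]
    refine (mul_le_of_le_one_right (Finset.prod_nonneg fun _ _ => abs_nonneg _) (hRle σ)).trans ?_
    exact le_of_eq (Finset.prod_congr rfl fun p _ => by rw [abs_div, abs_two])
  set X := ∑ σ : Equiv.Perm (Fin d), ∏ p ∈ S, |c (σ p) + c (σ (b p))| / 2 with hX
  have hX0 : 0 ≤ X := Finset.sum_nonneg fun _ _ => Finset.prod_nonneg fun _ _ => by positivity
  have hτ : 0 ≤ 1 - meanRe z ^ 2 := by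
    linarith [(sq_le_one_iff_abs_le_one _).mpr (abs_meanRe_le z)]
  have h1 : (d : ℝ) ^ 2 * ((S.card : ℝ) * (1 - meanRe z ^ 2) * X) ≤
      (d : ℝ) ^ 2 * (40 * d.factorial) := by
    calc _ = 4 * ((((d : ℝ) ^ 2 - (d * meanRe z) ^ 2) / 4) * S.card * X) := by ring
      _ ≤ 4 * (10 * (d : ℝ) ^ 2 * d.factorial) := by
        refine mul_le_mul_of_nonneg_left (le_trans ?_ hmain) (by norm_num)
        gcongr
      _ = _ := by ring
  refine le_trans ?_ (le_of_mul_le_mul_left h1 (by positivity))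
  gcongr

lemma ballMult_eq_sum_perm (N : ℕ) (z : Fin d → Circle) :
    ballMult d N z = (((ballFin d N).card : ℝ)⁻¹ * ∑ y ∈ ballFin d N,
      (d.factorial : ℝ)⁻¹ *
        ∑ σ : Equiv.Perm (Fin d), ∏ j, ((z (σ j) ^ y j : Circle) : ℂ).re : ℝ) := by
  rw [ballMult_eq_sum_re]
  congr 2
  have h := sum_eq_sum_average (ballFin d N)
    (fun σ : Equiv.Perm (Fin d) => Equiv.arrowCongr σ (Equiv.refl ℤ))
    (fun σ y => by
      simp only [mem_ballFin, Equiv.arrowCongr_apply, Function.comp, Equiv.refl_apply]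
      rw [Equiv.sum_comp σ.symm fun k => y k ^ 2])
    fun y => ((∏ j, ((z j ^ y j : Circle) : ℂ).re : ℝ) : ℂ)
  rw [Fintype.card_perm, Fintype.card_fin] at h
  have h' : ((∑ y ∈ ballFin d N, ∏ j, ((z j ^ y j : Circle) : ℂ).re : ℝ) : ℂ) =
      ((∑ y ∈ ballFin d N, (d.factorial : ℝ)⁻¹ * ∑ σ : Equiv.Perm (Fin d),
        ∏ j, ((z j ^ (Equiv.arrowCongr σ (Equiv.refl ℤ) y) j : Circle) : ℂ).re : ℝ) : ℂ) := by
    push_cast at h ⊢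
    exact h
  rw [Complex.ofReal_inj.mp h']
  refine Finset.sum_congr rfl fun y _ => ?_
  congr 1
  refine Finset.sum_congr rfl fun σ _ => ?_
  rw [← Equiv.prod_comp σ]
  simp [Equiv.arrowCongr_apply]

end Decay

section Concentration

variable {d : ℕ}

lemma pow_le_choose_mul_pow {n k : ℕ} (h : k ≤ n) : n ^ k ≤ n.choose k * k ^ k := by
  induction k generalizing n with
  | zero => simp
  | succ k ih =>
    obtain ⟨n, rfl⟩ : ∃ m, n = m + 1 := ⟨n - 1, by omega⟩
    have hk : k ≤ n := by omega
    have h1 : (n + 1) ^ k ≤ n.choose k * (k + 1) ^ k := by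
      have h2 : ((n + 1) * k) ^ k ≤ (n * (k + 1)) ^ k := Nat.pow_le_pow_left (by nlinarith) k
      rw [mul_pow, mul_pow] at h2
      have h3 : (n + 1) ^ k * k ^ k ≤ n.choose k * (k + 1) ^ k * k ^ k := by
        calc _ ≤ n ^ k * (k + 1) ^ k := h2
          _ ≤ n.choose k * k ^ k * (k + 1) ^ k := Nat.mul_le_mul_right _ (ih hk)
          _ = _ := by ring
      refine Nat.le_of_mul_le_mul_right h3 ?_
      rcases Nat.eq_zero_or_pos k with rfl | hk0
      · simp
      · positivity
    calc (n + 1) ^ (k + 1) = (n + 1) * (n + 1) ^ k := by ring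
      _ ≤ (n + 1) * (n.choose k * (k + 1) ^ k) := Nat.mul_le_mul_left _ h1
      _ = (n + 1) * n.choose k * (k + 1) ^ k := by ring
      _ = _ := by rw [Nat.add_one_mul_choose_eq]; ring

lemma two_pow_mul_choose_le_card_ballFin (d N : ℕ) :
    2 ^ N ^ 2 * d.choose (N ^ 2) ≤ (ballFin d N).card := by
  set T : Finset (Fin d) → Finset (Fin d → ℤ) := fun S =>
    Fintype.piFinset fun j => if j ∈ S then {1, -1} else {0} with hT
  have hmem : ∀ S y, y ∈ T S → ∀ j, y j ^ 2 = if j ∈ S then 1 else 0 := fun S y hy j => by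
    have := Fintype.mem_piFinset.mp hy j
    split_ifs at this ⊢ with h
    · rcases Finset.mem_insert.mp this with h1 | h1
      · rw [h1]; rfl
      · rw [Finset.mem_singleton.mp h1]; rfl
    · rw [Finset.mem_singleton.mp this]; rfl
  have hcardT : ∀ S ∈ Finset.powersetCard (N ^ 2) (Finset.univ : Finset (Fin d)),
      (T S).card = 2 ^ N ^ 2 := fun S hS => by
    have h1 : ∀ j, (if j ∈ S then ({1, -1} : Finset ℤ) else {0}).card = if j ∈ S then 2 else 1 :=
      fun j => by split_ifs <;> rfl
    rw [hT, Fintype.card_piFinset]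
    simp_rw [h1]
    rw [Finset.prod_ite_mem, Finset.univ_inter, Finset.prod_const, (Finset.mem_powersetCard.mp hS).2]
  have hdisj : ∀ S ∈ Finset.powersetCard (N ^ 2) (Finset.univ : Finset (Fin d)),
      ∀ S' ∈ Finset.powersetCard (N ^ 2) (Finset.univ : Finset (Fin d)), S ≠ S' →
        Disjoint (T S) (T S') := fun S _ S' _ hne => by
    rw [Finset.disjoint_left]
    intro y hy hy'
    apply hne
    ext j
    have h1 := hmem S y hy j
    have h2 := hmem S' y hy' j
    by_cases hj : j ∈ S <;> by_cases hj' : j ∈ S' <;> simp_all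
  calc 2 ^ N ^ 2 * d.choose (N ^ 2)
      = ((Finset.powersetCard (N ^ 2) (Finset.univ : Finset (Fin d))).biUnion T).card := by
        rw [Finset.card_biUnion hdisj, Finset.sum_congr rfl hcardT, Finset.sum_const,
          Finset.card_powersetCard]
        simp [mul_comm]
    _ ≤ _ := by
        refine Finset.card_le_card fun y hy => ?_
        obtain ⟨S, hS, hyS⟩ := Finset.mem_biUnion.mp hy
        rw [mem_ballFin, Finset.sum_congr rfl fun j _ => hmem S y hyS j, Finset.sum_ite_mem,
          Finset.univ_inter]
        simp [(Finset.mem_powersetCard.mp hS).2]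

/-- A Gaussian weight on the integers, damped at `1` and `-1`. -/
noncomputable def dampedWeight (x : ℝ) (u : ℤ) : ℝ :=
  x ^ u.natAbs ^ 2 * if u.natAbs = 1 then 1 / 16 else 1

lemma sum_dampedWeight_le {x : ℝ} (hx0 : 0 ≤ x) (hx : x ≤ 1 / 200) (N : ℕ) :
    ∑ u ∈ Finset.Icc (-(N : ℤ)) N, dampedWeight x u ≤ 1 + 27 / 200 * x := by
  have hstep : ∀ N : ℕ, ∑ u ∈ Finset.Icc (-((N + 1 : ℕ) : ℤ)) ((N + 1 : ℕ) : ℤ), dampedWeight x u =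
      ∑ u ∈ Finset.Icc (-(N : ℤ)) N, dampedWeight x u +
        2 * (x ^ (N + 1) ^ 2 * if N = 0 then 1 / 16 else 1) := fun N => by
    have h1 : Finset.Icc (-((N + 1 : ℕ) : ℤ)) ((N + 1 : ℕ) : ℤ) =
        insert ((N + 1 : ℕ) : ℤ) (insert (-((N + 1 : ℕ) : ℤ)) (Finset.Icc (-(N : ℤ)) N)) := by
      ext u
      simp only [Finset.mem_insert, Finset.mem_Icc]
      omega
    rw [h1, Finset.sum_insert, Finset.sum_insert]
    · simp only [dampedWeight, Int.natAbs_neg, Int.natAbs_natCast, Nat.add_eq_right]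
      ring
    · simp only [Finset.mem_Icc]; omega
    · simp only [Finset.mem_insert, Finset.mem_Icc]; omega
  have hmain : ∀ N : ℕ, ∑ u ∈ Finset.Icc (-((N + 1 : ℕ) : ℤ)) ((N + 1 : ℕ) : ℤ), dampedWeight x u ≤
      1 + 27 / 200 * x - x ^ (N + 3) := fun N => by
    induction N with
    | zero =>
      rw [hstep]
      simp [dampedWeight]
      nlinarith [mul_nonneg hx0 hx0, mul_nonneg hx0 (mul_nonneg hx0 hx0)]
    | succ N ih =>
      rw [hstep]
      have h2 : x ^ (N + 1 + 1) ^ 2 ≤ x ^ (N + 4) :=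
        pow_le_pow_of_le_one hx0 (by linarith) (by nlinarith)
      have h3 : 3 * x ^ (N + 4) ≤ x ^ (N + 3) := by
        rw [pow_succ x (N + 3)]
        nlinarith [pow_nonneg hx0 (N + 3)]
      have h4 : x ^ (N + 1 + 3) = x ^ (N + 4) := by ring
      simp only [Nat.add_eq_zero_iff, one_ne_zero, and_false, if_false, mul_one, h4]
      linarith
  cases N with
  | zero => simp [dampedWeight]; linarith
  | succ N => linarith [hmain N, pow_nonneg hx0 (N + 3)]

/-- Few points of a small ball have few coordinates equal to `1` or `-1`. -/
lemma card_few_unitCoords_mul_le {N : ℕ} (hN1 : 1 ≤ N) (hN : 200 * N ^ 2 ≤ d) :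
    (((ballFin d N).filter fun y => 16 * (unitCoords y).card ≤ N ^ 2).card : ℝ) * (N : ℝ) ^ 2 ≤
      3 * (ballFin d N).card := by
  set F := (ballFin d N).filter fun y => 16 * (unitCoords y).card ≤ N ^ 2 with hF
  set k : ℕ := N ^ 2 with hk
  have hk1 : 1 ≤ k := Nat.one_le_pow _ _ hN1
  have hk1' : (1 : ℝ) ≤ k := by exact_mod_cast hk1
  have hkd : 200 * (k : ℝ) ≤ d := by exact_mod_cast hN
  have hd0 : (0 : ℝ) < d := by linarith
  set x : ℝ := k / d with hx
  have hx0 : 0 < x := by positivity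
  have hx1 : x ≤ 1 / 200 := by rw [hx, div_le_iff₀ hd0]; linarith
  have hω0 : ∀ u, 0 ≤ dampedWeight x u := fun u => by
    unfold dampedWeight; split_ifs <;> positivity
  have hprod : ∀ y : Fin d → ℤ, ∏ j, dampedWeight x (y j) =
      x ^ (∑ j, (y j).natAbs ^ 2) * (1 / 16) ^ (unitCoords y).card := fun y => by
    simp only [dampedWeight]
    rw [Finset.prod_mul_distrib, Finset.prod_pow_eq_pow_sum, ← Finset.prod_filter,
      Finset.prod_const, unitCoords]
  have hlow : ∀ y ∈ F, (5 / 6 * x) ^ k ≤ ∏ j, dampedWeight x (y j) := fun y hy => by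
    obtain ⟨hyB, hyu⟩ := Finset.mem_filter.mp hy
    have hsq : ∑ j, (y j).natAbs ^ 2 ≤ k := by
      have h := mem_ballFin.mp hyB
      zify
      simpa [sq_abs, hk] using h
    rw [hprod, mul_pow, mul_comm]
    gcongr ?_ * ?_
    · exact pow_le_pow_of_le_one hx0.le (by linarith) hsq
    · calc (5 / 6 : ℝ) ^ k ≤ (5 / 6) ^ (16 * (unitCoords y).card) :=
            pow_le_pow_of_le_one (by norm_num) (by norm_num) hyu
        _ = ((5 / 6) ^ 16) ^ (unitCoords y).card := pow_mul _ _ _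
        _ ≤ _ := pow_le_pow_left₀ (by norm_num) (by norm_num) _
  have hupper : (F.card : ℝ) * (5 / 6 * x) ^ k ≤ (1 + 27 / 200 * x) ^ d := by
    calc (F.card : ℝ) * (5 / 6 * x) ^ k = ∑ y ∈ F, (5 / 6 * x) ^ k := by simp
      _ ≤ ∑ y ∈ F, ∏ j, dampedWeight x (y j) := Finset.sum_le_sum hlow
      _ ≤ ∑ y ∈ Fintype.piFinset fun _ : Fin d => Finset.Icc (-(N : ℤ)) N,
            ∏ j, dampedWeight x (y j) :=
          Finset.sum_le_sum_of_subset_of_nonneg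
            ((Finset.filter_subset _ _).trans (Finset.filter_subset _ _))
            fun y _ _ => Finset.prod_nonneg fun j _ => hω0 _
      _ = (∑ u ∈ Finset.Icc (-(N : ℤ)) N, dampedWeight x u) ^ d := by
          rw [← Finset.prod_univ_sum]; simp
      _ ≤ _ := pow_le_pow_left₀ (Finset.sum_nonneg fun u _ => hω0 u)
          (sum_dampedWeight_le hx0.le hx1 N) d
  have hexp : (1 + 27 / 200 * x) ^ d ≤ (200 / 173 : ℝ) ^ k := by
    calc (1 + 27 / 200 * x) ^ d ≤ Real.exp (27 / 200 * x) ^ d :=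
          pow_le_pow_left₀ (by positivity) (by linarith [Real.add_one_le_exp (27 / 200 * x)]) d
      _ = Real.exp (27 / 200) ^ k := by
          rw [← Real.exp_nat_mul, ← Real.exp_nat_mul]
          congr 1
          rw [hx]; field_simp
      _ ≤ _ := by
          refine pow_le_pow_left₀ (Real.exp_pos _).le ?_ k
          have h := Real.one_sub_le_exp_neg (27 / 200)
          rw [Real.exp_neg] at h
          rw [← inv_le_inv₀ (by norm_num) (Real.exp_pos _)]
          linarith
  have hball : (2 / x) ^ k ≤ (ballFin d N).card := by
    have h1 := two_pow_mul_choose_le_card_ballFin d N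
    have h2 := pow_le_choose_mul_pow (n := d) (k := k) (by omega)
    have h1' : (2 : ℝ) ^ k * d.choose k ≤ (ballFin d N).card := by exact_mod_cast h1
    have h2' : (d : ℝ) ^ k ≤ d.choose k * (k : ℝ) ^ k := by exact_mod_cast h2
    refine le_trans ?_ h1'
    rw [hx, div_div_eq_mul_div, mul_div_assoc, mul_pow, div_pow]
    gcongr
    rwa [div_le_iff₀ (by positivity)]
  have hgeom : (3 / 4 : ℝ) ^ k * k ≤ 3 := by
    have h := one_add_mul_le_pow (a := (1 / 3 : ℝ)) (by norm_num) k
    have h2 : (3 / 4 : ℝ) ^ k * (1 + 1 / 3) ^ k = 1 := by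
      rw [← mul_pow]; norm_num
    have h3 : (0 : ℝ) < (3 / 4) ^ k := by positivity
    nlinarith
  have hcast : ((N : ℝ)) ^ 2 = k := by rw [hk]; push_cast; rfl
  rw [hcast]
  have hFle : (F.card : ℝ) ≤ (3 / 4) ^ k * (ballFin d N).card := by
    have h5 : 0 < (5 / 6 * x) ^ k := by positivity
    refine le_of_mul_le_mul_right (hupper.trans (hexp.trans ?_)) h5
    calc (200 / 173 : ℝ) ^ k ≤ (3 / 4 * (2 / x) * (5 / 6 * x)) ^ k := by
          refine pow_le_pow_left₀ (by norm_num) ?_ k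
          have : 3 / 4 * (2 / x) * (5 / 6 * x) = 5 / 4 := by field_simp; norm_num
          rw [this]; norm_num
      _ = (3 / 4) ^ k * (2 / x) ^ k * (5 / 6 * x) ^ k := by rw [mul_pow, mul_pow]
      _ ≤ _ := by gcongr
  calc (F.card : ℝ) * k ≤ (3 / 4) ^ k * (ballFin d N).card * k := by gcongr
    _ = ((3 / 4) ^ k * k) * (ballFin d N).card := by ring
    _ ≤ _ := by gcongr

/-- Decay of the multiplier of a small ball away from the two frequencies where it is extremal. -/
lemma norm_ballMult_mul_le {N : ℕ} (hN1 : 1 ≤ N) (hN : 200 * N ^ 2 ≤ d) (z : Fin d → Circle) :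
    ‖ballMult d N z‖ * ((N : ℝ) ^ 2 * (1 - meanRe z ^ 2)) ≤ 643 := by
  have hd : 2 ≤ d := by nlinarith [Nat.one_le_pow 2 N hN1]
  have hpos : (0 : ℝ) < (ballFin d N).card := by exact_mod_cast card_ballFin_pos d N
  have hfac : (0 : ℝ) < d.factorial := by exact_mod_cast Nat.factorial_pos d
  set τ := 1 - meanRe z ^ 2 with hτ
  have hτ0 : 0 ≤ τ := by linarith [(sq_le_one_iff_abs_le_one _).mpr (abs_meanRe_le z)]
  have hτ1 : τ ≤ 1 := by linarith [sq_nonneg (meanRe z)]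
  set Φ : (Fin d → ℤ) → ℝ := fun y => (d.factorial : ℝ)⁻¹ *
    ∑ σ : Equiv.Perm (Fin d), ∏ j, ((z (σ j) ^ y j : Circle) : ℂ).re with hΦ
  have hΦ1 : ∀ y, |Φ y| ≤ 1 := fun y => by
    rw [hΦ, abs_mul, abs_inv, Nat.abs_cast, inv_mul_le_iff₀ hfac, mul_one]
    refine (Finset.abs_sum_le_sum_abs _ _).trans ?_
    refine (Finset.sum_le_card_nsmul _ _ 1 fun σ _ => ?_).trans ?_
    · rw [Finset.abs_prod]
      exact Finset.prod_le_one (fun _ _ => abs_nonneg _) fun _ _ => abs_re_circle_le _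
    · simp [Fintype.card_perm]
  have hbound : ∀ y ∈ ballFin d N, |Φ y| * ((N : ℝ) ^ 2 * τ) ≤
      640 + if 16 * (unitCoords y).card ≤ N ^ 2 then (N : ℝ) ^ 2 else 0 := fun y hy => by
    split_ifs with h
    · have h1 : |Φ y| * ((N : ℝ) ^ 2 * τ) ≤ 1 * ((N : ℝ) ^ 2 * 1) := by
        gcongr
        exact hΦ1 y
      linarith
    · have h1 := abs_sum_perm_prod_re_le hd hN hy z
      have h2 : (unitCoords y).card * τ * |Φ y| ≤ 40 := by
        rw [hΦ, abs_mul, abs_inv, Nat.abs_cast, mul_left_comm, inv_mul_le_iff₀ hfac]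
        linarith
      have h3 : (N : ℝ) ^ 2 ≤ 16 * (unitCoords y).card := by
        have : N ^ 2 ≤ 16 * (unitCoords y).card := by omega
        exact_mod_cast this
      calc |Φ y| * ((N : ℝ) ^ 2 * τ) ≤ |Φ y| * (16 * (unitCoords y).card * τ) := by gcongr
        _ = 16 * ((unitCoords y).card * τ * |Φ y|) := by ring
        _ ≤ _ := by linarith
  rw [ballMult_eq_sum_perm, Complex.norm_real, Real.norm_eq_abs, abs_mul, abs_inv, Nat.abs_cast,
    mul_assoc, inv_mul_le_iff₀ hpos]
  calc |∑ y ∈ ballFin d N, Φ y| * ((N : ℝ) ^ 2 * τ)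
      ≤ (∑ y ∈ ballFin d N, |Φ y|) * ((N : ℝ) ^ 2 * τ) := by
        gcongr; exact Finset.abs_sum_le_sum_abs _ _
    _ ≤ ∑ y ∈ ballFin d N,
          (640 + if 16 * (unitCoords y).card ≤ N ^ 2 then (N : ℝ) ^ 2 else 0) := by
        rw [Finset.sum_mul]; exact Finset.sum_le_sum hbound
    _ = 640 * (ballFin d N).card +
          (((ballFin d N).filter fun y => 16 * (unitCoords y).card ≤ N ^ 2).card : ℝ) *
            (N : ℝ) ^ 2 := by
        rw [Finset.sum_add_distrib, ← Finset.sum_filter]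
        simp [mul_comm]
    _ ≤ _ := by linarith [card_few_unitCoords_mul_le hN1 hN]

/-- Almost orthogonality of the ball multipliers at distinct dyadic scales. -/
lemma norm_ballMult_mul_norm_sub_le {m n : ℕ} (hmn : m ≤ n) (hn : 200 * (2 ^ n) ^ 2 ≤ d)
    (z : Fin d → Circle) :
    ‖ballMult d (2 ^ n) z‖ * ‖ballMult d (2 ^ m) z - parityMult d (2 ^ m) (meanRe z)‖ ≤
      1286 * (1 / 4) ^ (n - m) := by
  have hd : 1 ≤ d := by nlinarith [Nat.one_le_pow 2 (2 ^ n) Nat.one_le_two_pow]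
  have h1 := norm_ballMult_sub_parityMult_le hd (Nat.one_le_two_pow (n := m)) z
  have h2 := norm_ballMult_mul_le Nat.one_le_two_pow hn z
  obtain ⟨l, rfl⟩ := Nat.exists_eq_add_of_le hmn
  rw [Nat.add_sub_cancel_left]
  have h4 : (1 / 4 : ℝ) ^ l * (((2 ^ (m + l) : ℕ) : ℝ)) ^ 2 = (((2 ^ m : ℕ) : ℝ)) ^ 2 := by
    push_cast
    have : (4 : ℝ) ^ l = (2 ^ l) ^ 2 := by rw [← pow_mul, mul_comm, pow_mul]; norm_num
    rw [pow_add, one_div, inv_pow, this]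
    field_simp
  calc _ ≤ ‖ballMult d (2 ^ (m + l)) z‖ *
        (2 * (((2 ^ m : ℕ) : ℝ)) ^ 2 * (1 - meanRe z ^ 2)) := by gcongr
    _ = 2 * (1 / 4) ^ l * (‖ballMult d (2 ^ (m + l)) z‖ *
        ((((2 ^ (m + l) : ℕ) : ℝ)) ^ 2 * (1 - meanRe z ^ 2))) := by rw [← h4]; ring
    _ ≤ 2 * (1 / 4) ^ l * 643 := by gcongr
    _ = _ := by ring

end Concentration

section Kernels

variable {d : ℕ}

/-- The kernel of the averaging operator over the ball. -/
noncomputable def ballKernel (d N : ℕ) : AddMonoidAlgebra ℝ (Fin d → ℤ) :=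
  ((ballFin d N).card : ℝ)⁻¹ • ∑ y ∈ ballFin d N, single y 1

/-- The kernel of the simple random walk on `ℤ^d`. -/
noncomputable def stepKernel (d : ℕ) : AddMonoidAlgebra ℝ (Fin d → ℤ) :=
  (2 * d : ℝ)⁻¹ • ∑ j, (single (Pi.single j 1) 1 + single (Pi.single j (-1)) 1)

/-- The mixture of the identity and the simple random walk, weighted by the proportion of even and
odd points in the ball. -/
noncomputable def parityKernel (d N : ℕ) : AddMonoidAlgebra ℝ (Fin d → ℤ) :=
  ((ballFin d N).card : ℝ)⁻¹ • ∑ y ∈ ballFin d N, if Even (∑ j, y j) then 1 else stepKernel d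

lemma coeff_sum_apply {ι : Type*} (s : Finset ι) (a : ι → AddMonoidAlgebra ℝ (Fin d → ℤ))
    (x : Fin d → ℤ) : (∑ i ∈ s, a i).coeff x = ∑ i ∈ s, (a i).coeff x := by
  have : (∑ i ∈ s, a i).coeff = ∑ i ∈ s, (a i).coeff :=
    map_sum (AddMonoidAlgebra.coeffLinearEquiv ℝ) a s
  rw [this, Finsupp.finsetSum_apply]

lemma coeff_single_nonneg (y x : Fin d → ℤ) {r : ℝ} (hr : 0 ≤ r) :
    0 ≤ (single y r : AddMonoidAlgebra ℝ (Fin d → ℤ)).coeff x := by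
  classical
  rw [coeff_single, Finsupp.single_apply]
  split_ifs
  · exact hr
  · exact le_rfl

lemma ballKernel_nonneg (N : ℕ) (x : Fin d → ℤ) : 0 ≤ (ballKernel d N).coeff x := by
  rw [ballKernel, coeff_smul, Finsupp.smul_apply, coeff_sum_apply, smul_eq_mul]
  exact mul_nonneg (by positivity) (Finset.sum_nonneg fun y _ => coeff_single_nonneg _ _ zero_le_one)

lemma stepKernel_nonneg (x : Fin d → ℤ) : 0 ≤ (stepKernel d).coeff x := by
  rw [stepKernel, coeff_smul, Finsupp.smul_apply, coeff_sum_apply, smul_eq_mul]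
  refine mul_nonneg (by positivity) (Finset.sum_nonneg fun y _ => ?_)
  rw [coeff_add, Finsupp.add_apply]
  exact add_nonneg (coeff_single_nonneg _ _ zero_le_one) (coeff_single_nonneg _ _ zero_le_one)

lemma one_add_stepKernel_nonneg (x : Fin d → ℤ) : 0 ≤ (1 + stepKernel d).coeff x := by
  rw [coeff_add, Finsupp.add_apply, AddMonoidAlgebra.one_def]
  exact add_nonneg (coeff_single_nonneg _ _ zero_le_one) (stepKernel_nonneg x)

lemma parityKernel_le (N : ℕ) (x : Fin d → ℤ) :
    (parityKernel d N).coeff x ≤ (1 + stepKernel d).coeff x := by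
  have hc : (0 : ℝ) < (ballFin d N).card := by exact_mod_cast card_ballFin_pos d N
  rw [parityKernel, coeff_smul, Finsupp.smul_apply, coeff_sum_apply, smul_eq_mul,
    inv_mul_le_iff₀ hc, ← nsmul_eq_mul]
  refine Finset.sum_le_card_nsmul _ _ _ fun y _ => ?_
  rw [coeff_add, Finsupp.add_apply]
  split_ifs
  · exact le_add_of_nonneg_right (stepKernel_nonneg x)
  · refine le_add_of_nonneg_left ?_
    rw [AddMonoidAlgebra.one_def]
    exact coeff_single_nonneg _ _ zero_le_one

lemma mFourier_apply_eq_prod (y : Fin d → ℤ) (t : UnitAddTorus (Fin d)) :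
    mFourier y t = ∏ j, (AddCircle.toCircle (t j) : ℂ) ^ y j := by
  have : mFourier y t = ∏ i, fourier (y i) (t i) := rfl
  rw [this]
  refine Finset.prod_congr rfl fun j _ => ?_
  rw [fourier_apply, AddCircle.toCircle_zsmul, Circle.coe_zpow]

lemma fourierHat_ballKernel (N : ℕ) (t : UnitAddTorus (Fin d)) :
    fourierHat d (ballKernel d N) t = ballMult d N fun j => AddCircle.toCircle (t j) := by
  rw [ballKernel, map_smul, map_sum, ballMult]
  simp only [fourierHat_single, one_smul, ContinuousMap.smul_apply, ContinuousMap.sum_apply,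
    mFourier_apply_eq_prod, Complex.real_smul]
  push_cast
  rfl

lemma fourierHat_stepKernel (t : UnitAddTorus (Fin d)) :
    fourierHat d (stepKernel d) t = (meanRe (fun j => AddCircle.toCircle (t j)) : ℝ) := by
  rw [stepKernel, map_smul, map_sum, meanRe]
  have h : ∀ (j : Fin d) (k : ℤ), mFourier (Pi.single j k) t = (AddCircle.toCircle (t j) : ℂ) ^ k := by
    intro j k
    rw [mFourier_apply_eq_prod, Finset.prod_eq_single j]
    · simp
    · intro i _ hij; simp [hij]
    · simp
  simp only [map_add, fourierHat_single, one_smul, ContinuousMap.smul_apply,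
    ContinuousMap.sum_apply, ContinuousMap.add_apply, h, Complex.real_smul, zpow_one, zpow_neg]
  have h2 : ∀ z : Circle, (z : ℂ) + (z : ℂ)⁻¹ = 2 * ((z : ℂ).re : ℂ) := fun z => by
    rw [← Circle.coe_inv, Circle.coe_inv_eq_conj, Complex.add_conj]
    push_cast; ring
  simp_rw [h2, ← Finset.mul_sum]
  push_cast
  rw [mul_inv]
  ring

lemma fourierHat_parityKernel (N : ℕ) (t : UnitAddTorus (Fin d)) :
    fourierHat d (parityKernel d N) t =
      (parityMult d N (meanRe fun j => AddCircle.toCircle (t j)) : ℝ) := by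
  rw [parityKernel, map_smul, map_sum, parityMult]
  simp only [ContinuousMap.smul_apply, ContinuousMap.sum_apply, Complex.real_smul]
  push_cast
  congr 1
  refine Finset.sum_congr rfl fun y _ => ?_
  split_ifs
  · simp
  · exact fourierHat_stepKernel t

lemma norm_fourierHat_one_add_stepKernel_le (t : UnitAddTorus (Fin d)) :
    ‖fourierHat d (1 + stepKernel d) t‖ ≤ 2 := by
  rw [map_add, map_one, ContinuousMap.add_apply, ContinuousMap.one_apply, fourierHat_stepKernel]
  refine (norm_add_le _ _).trans ?_
  rw [norm_one, Complex.norm_real, Real.norm_eq_abs]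
  linarith [abs_meanRe_le fun j => AddCircle.toCircle (t j)]

end Kernels

section Maximal

variable {d : ℕ}

/-- The average of a real function over the ball. -/
noncomputable def ballMean (N : ℕ) (a : (Fin d → ℤ) → ℝ) (x : Fin d → ℤ) : ℝ :=
  ((ballFin d N).card : ℝ)⁻¹ * ∑ y ∈ ballFin d N, a (x - y)

lemma ballMean_nonneg (N : ℕ) {a : (Fin d → ℤ) → ℝ} (ha : ∀ x, 0 ≤ a x) (x : Fin d → ℤ) :
    0 ≤ ballMean N a x :=
  mul_nonneg (by positivity) (Finset.sum_nonneg fun _ _ => ha _)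

/-- Pairing of a finitely supported function with an arbitrary function. -/
noncomputable def pairing (a : (Fin d → ℤ) → ℝ) : AddMonoidAlgebra ℝ (Fin d → ℤ) →ₗ[ℝ] ℝ :=
  Finsupp.linearCombination ℝ a ∘ₗ (AddMonoidAlgebra.coeffLinearEquiv ℝ).toLinearMap

lemma pairing_apply (a : (Fin d → ℤ) → ℝ) (b : AddMonoidAlgebra ℝ (Fin d → ℤ)) :
    pairing a b = ∑ x ∈ b.coeff.support, b.coeff x * a x := rfl

lemma pairing_single (a : (Fin d → ℤ) → ℝ) (x : Fin d → ℤ) (r : ℝ) :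
    pairing a (single x r) = r * a x := by
  change Finsupp.linearCombination ℝ a (Finsupp.single x r) = _
  rw [Finsupp.linearCombination_single, smul_eq_mul]

lemma pairing_ballKernel_mul_single (N : ℕ) (a : (Fin d → ℤ) → ℝ) (x : Fin d → ℤ) (r : ℝ) :
    pairing a (ballKernel d N * single x r) = r * ballMean N a x := by
  rw [ballKernel, smul_mul_assoc, Finset.sum_mul, map_smul, map_sum, ballMean]
  simp only [single_mul_single, one_mul, pairing_single, smul_eq_mul]
  rw [← Finset.mul_sum, mul_left_comm]
  congr 2
  refine Finset.sum_equiv (Equiv.neg _) (fun y => ?_) fun y _ => ?_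
  · simp [mem_ballFin]
  · rw [Equiv.neg_apply, sub_neg_eq_add, add_comm]

lemma pairing_sq_le {a : (Fin d → ℤ) → ℝ} {W : ℝ} (hW : ∀ E : Finset (Fin d → ℤ), ∑ x ∈ E, a x ^ 2 ≤ W)
    (b : AddMonoidAlgebra ℝ (Fin d → ℤ)) : pairing a b ^ 2 ≤ innerForm d b b * W := by
  rw [pairing_apply, innerForm_apply]
  refine (Finset.sum_mul_sq_le_sq_mul_sq _ _ _).trans ?_
  simp_rw [← sq]
  exact mul_le_mul_of_nonneg_left (hW _) (Finset.sum_nonneg fun _ _ => sq_nonneg _)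

/-- The linearized dyadic maximal operator is bounded on `ℓ²`, by duality. -/
theorem sum_ballMean_sq_le (I : Finset ℕ) {A : ℝ} (hA : 0 ≤ A)
    (h : ∀ n ∈ I, ∀ m ∈ I, m ≤ n → ∀ z : Fin d → Circle,
      ‖ballMult d (2 ^ n) z‖ * ‖ballMult d (2 ^ m) z - parityMult d (2 ^ m) (meanRe z)‖ ≤
        A * (1 / 4) ^ (n - m))
    {a : (Fin d → ℤ) → ℝ} (ha : ∀ x, 0 ≤ a x) {W : ℝ}
    (hW : ∀ E : Finset (Fin d → ℤ), ∑ x ∈ E, a x ^ 2 ≤ W) (F : Finset (Fin d → ℤ))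
    (ν : (Fin d → ℤ) → ℕ) (hν : ∀ x, ν x ∈ I) :
    ∑ x ∈ F, ballMean (2 ^ ν x) a x ^ 2 ≤ (16 + 8 * A) * W := by
  set G : (Fin d → ℤ) → ℝ := fun x => ballMean (2 ^ ν x) a x with hG
  set g : ℕ → AddMonoidAlgebra ℝ (Fin d → ℤ) := fun n => ∑ x ∈ F with ν x = n, single x (G x)
    with hg
  set k : ℕ → AddMonoidAlgebra ℝ (Fin d → ℤ) := fun n => ballKernel d (2 ^ n) with hk
  have hG0 : ∀ x, 0 ≤ G x := fun x => ballMean_nonneg _ ha x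
  have hgsum : ∑ n ∈ I, g n = ∑ x ∈ F, single x (G x) :=
    Finset.sum_fiberwise_of_maps_to (fun x _ => hν x) _
  have hkg : ∑ n ∈ I, k n * g n = ∑ x ∈ F, ballKernel d (2 ^ ν x) * single x (G x) := by
    rw [← Finset.sum_fiberwise_of_maps_to (t := I) (g := ν) fun x _ => hν x]
    refine Finset.sum_congr rfl fun n _ => ?_
    rw [hg, Finset.mul_sum]
    refine Finset.sum_congr rfl fun x hx => ?_
    rw [(Finset.mem_filter.mp hx).2]
  have hUU : innerForm d (∑ n ∈ I, g n) (∑ n ∈ I, g n) = ∑ x ∈ F, G x ^ 2 := by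
    classical
    have hc : ∀ x, (∑ n ∈ I, g n).coeff x = if x ∈ F then G x else 0 := fun x => by
      rw [hgsum, coeff_sum_apply]
      simp [coeff_single, Finsupp.single_apply]
    rw [innerForm_eq_sum (F := F)]
    · refine Finset.sum_congr rfl fun x hx => ?_
      rw [hc, if_pos hx, sq]
    · intro x hx
      by_contra hxF
      rw [Finsupp.mem_support_iff, hc, if_neg hxF] at hx
      exact hx rfl
  have hmain := innerForm_sum_mul_le I k (fun n => parityKernel d (2 ^ n)) g (1 + stepKernel d) hA
    (fun n => ballKernel_nonneg _) one_add_stepKernel_nonneg (fun n => parityKernel_le _)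
    (fun n x => by
      rw [hg, coeff_sum_apply]
      exact Finset.sum_nonneg fun y _ => coeff_single_nonneg _ _ (hG0 y))
    norm_fourierHat_one_add_stepKernel_le
    (fun n hn m hm hmn t => by
      rw [fourierHat_ballKernel, fourierHat_ballKernel, fourierHat_parityKernel]
      exact h n hn m hm hmn _)
  have hL : pairing a (∑ n ∈ I, k n * g n) = ∑ x ∈ F, G x ^ 2 := by
    rw [hkg, map_sum]
    exact Finset.sum_congr rfl fun x _ => by rw [pairing_ballKernel_mul_single, sq]
  have hCS := pairing_sq_le hW (∑ n ∈ I, k n * g n)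
  rw [hUU] at hmain
  rw [hL] at hCS
  have hW0 : 0 ≤ W := by simpa using hW ∅
  have hX0 : 0 ≤ ∑ x ∈ F, G x ^ 2 := Finset.sum_nonneg fun _ _ => sq_nonneg _
  change ∑ x ∈ F, G x ^ 2 ≤ _
  have hfin : (∑ x ∈ F, G x ^ 2) * ∑ x ∈ F, G x ^ 2 ≤ (∑ x ∈ F, G x ^ 2) * ((16 + 8 * A) * W) := by
    nlinarith [mul_le_mul_of_nonneg_right hmain hW0]
  rcases hX0.eq_or_lt with h0 | h0
  · rw [← h0]; positivity
  · exact le_of_mul_le_mul_left hfin h0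

end Maximal

section SquareSum

variable {d : ℕ}

lemma tsum_sup_ballMean_sq_le (I : Finset ℕ) {A : ℝ} (hA : 0 ≤ A)
    (h : ∀ n ∈ I, ∀ m ∈ I, m ≤ n → ∀ z : Fin d → Circle,
      ‖ballMult d (2 ^ n) z‖ * ‖ballMult d (2 ^ m) z - parityMult d (2 ^ m) (meanRe z)‖ ≤
        A * (1 / 4) ^ (n - m))
    (f : (Fin d → ℤ) → ℂ) :
    ∑' x, (I.sup fun n => ENNReal.ofReal (ballMean (2 ^ n) (fun y => ‖f y‖) x)) ^ 2 ≤
      ENNReal.ofReal (16 + 8 * A) * ∑' x, ‖f x‖ₑ ^ 2 := by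
  rcases I.eq_empty_or_nonempty with rfl | hI
  · simp
  have hpos : 0 < 16 + 8 * A := by positivity
  by_cases htop : ∑' x, ‖f x‖ₑ ^ 2 = ∞
  · rw [htop, ENNReal.mul_top (by simpa using hpos)]
    exact le_top
  choose ν hν hνs using fun x => Finset.exists_mem_eq_sup I hI
    fun n => ENNReal.ofReal (ballMean (2 ^ n) (fun y => ‖f y‖) x)
  have henorm : ∀ x, ENNReal.ofReal (‖f x‖ ^ 2) = ‖f x‖ₑ ^ 2 := fun x => by
    rw [ENNReal.ofReal_pow (norm_nonneg _), ofReal_norm]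
  have hW : ∀ E : Finset (Fin d → ℤ), ∑ x ∈ E, ‖f x‖ ^ 2 ≤ (∑' x, ‖f x‖ₑ ^ 2).toReal := fun E => by
    rw [← ENNReal.ofReal_le_iff_le_toReal htop,
      ENNReal.ofReal_sum_of_nonneg fun _ _ => sq_nonneg _]
    simp_rw [henorm]
    exact ENNReal.sum_le_tsum E
  rw [ENNReal.tsum_eq_iSup_sum]
  refine iSup_le fun F => ?_
  have hmain := sum_ballMean_sq_le I hA h (fun x => norm_nonneg (f x)) hW F ν hν
  have heq : ∑ x ∈ F, (I.sup fun n => ENNReal.ofReal (ballMean (2 ^ n) (fun y => ‖f y‖) x)) ^ 2 =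
      ENNReal.ofReal (∑ x ∈ F, ballMean (2 ^ ν x) (fun y => ‖f y‖) x ^ 2) := by
    rw [ENNReal.ofReal_sum_of_nonneg fun _ _ => sq_nonneg _]
    refine Finset.sum_congr rfl fun x _ => ?_
    rw [hνs, ENNReal.ofReal_pow (ballMean_nonneg _ (fun y => norm_nonneg _) x)]
  rw [heq]
  refine (ENNReal.ofReal_le_ofReal hmain).trans ?_
  rw [ENNReal.ofReal_mul hpos.le, ENNReal.ofReal_toReal htop]

lemma tsum_ballMean_sq_le (n : ℕ) (f : (Fin d → ℤ) → ℂ) :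
    ∑' x, ENNReal.ofReal (ballMean (2 ^ n) (fun y => ‖f y‖) x) ^ 2 ≤
      ENNReal.ofReal 32 * ∑' x, ‖f x‖ₑ ^ 2 := by
  have h := tsum_sup_ballMean_sq_le (d := d) {n} zero_le_two (fun k hk m hm _ z => by
    rw [Finset.mem_singleton.mp hk, Finset.mem_singleton.mp hm, Nat.sub_self, pow_zero, mul_one]
    exact (mul_le_mul (norm_ballMult_le_one _ z) (norm_ballMult_sub_parityMult_le_two _ z)
      (norm_nonneg _) zero_le_one).trans_eq (one_mul _)) f
  norm_num at h ⊢
  exact h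

lemma latticeBallSet_eq_ballFin (N : ℕ) : latticeBallSet d N = ballFin d N := by
  ext y
  rw [Finset.mem_coe, mem_ballFin, latticeBallSet, Set.mem_ofPred_eq]
  exact_mod_cast Iff.rfl

lemma enorm_ballAvg_le (n : ℕ) (f : (Fin d → ℤ) → ℂ) (x : Fin d → ℤ) :
    ‖ballAvg d ((2 : ℝ) ^ n) f x‖ₑ ≤ ENNReal.ofReal (ballMean (2 ^ n) (fun y => ‖f y‖) x) := by
  have hcast : (2 : ℝ) ^ n = ((2 ^ n : ℕ) : ℝ) := by push_cast; rfl
  rw [← ofReal_norm, ballAvg, hcast, latticeBallSet_eq_ballFin, Set.ncard_coe_finset,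
    finsum_mem_coe_finset]
  refine ENNReal.ofReal_le_ofReal ?_
  rw [norm_div, Complex.norm_natCast, div_eq_inv_mul, ballMean]
  exact mul_le_mul_of_nonneg_left (norm_sum_le _ _) (by positivity)

/-- The scales `2 ^ n ≤ c √d` which are not much smaller than `√d` number at most `h`. -/
lemma exists_intermediate_scales (d : ℕ) {c : ℝ} {h : ℕ} (hh : 200 * c ^ 2 < 4 ^ h) :
    ∃ n₀ : ℕ, ∀ n : ℕ, (2 : ℝ) ^ n ≤ c * √d → d < 200 * (2 ^ n) ^ 2 →
      n ∈ Finset.Ico n₀ (n₀ + h) := by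
  classical
  have hex : ∃ n : ℕ, d < 200 * (2 ^ n) ^ 2 := by
    refine ⟨d, ?_⟩
    have := Nat.lt_two_pow_self (n := d)
    nlinarith
  refine ⟨Nat.find hex, fun n hn hdn => ?_⟩
  have hle := Nat.find_min' hex hdn
  have hspec := Nat.find_spec hex
  set n₀ := Nat.find hex
  rw [Finset.mem_Ico]
  refine ⟨hle, ?_⟩
  have hspec' : (d : ℝ) < 200 * (4 : ℝ) ^ n₀ := by
    have : (d : ℝ) < 200 * ((2 : ℝ) ^ n₀) ^ 2 := by exact_mod_cast hspec
    rwa [← pow_mul, mul_comm n₀, pow_mul, show (2 : ℝ) ^ 2 = 4 by norm_num] at this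
  have h1 : (4 : ℝ) ^ n ≤ c ^ 2 * d := by
    have := pow_le_pow_left₀ (by positivity) hn 2
    rwa [mul_pow, Real.sq_sqrt (Nat.cast_nonneg d), ← pow_mul, mul_comm n, pow_mul,
      show (2 : ℝ) ^ 2 = 4 by norm_num] at this
  have h2 : (4 : ℝ) ^ n < 4 ^ (n₀ + h) := by
    rcases eq_or_ne c 0 with rfl | hc
    · have : (0 : ℝ) < 4 ^ n := by positivity
      simp at h1
      linarith
    calc (4 : ℝ) ^ n ≤ c ^ 2 * d := h1
      _ < c ^ 2 * (200 * 4 ^ n₀) := mul_lt_mul_of_pos_left hspec' (by positivity)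
      _ = 4 ^ n₀ * (200 * c ^ 2) := by ring
      _ < 4 ^ n₀ * 4 ^ h := mul_lt_mul_of_pos_left hh (by positivity)
      _ = _ := (pow_add _ _ _).symm
  exact (pow_lt_pow_iff_right₀ (by norm_num)).mp h2

lemma tsum_iSup_ballAvg_sq_le {c : ℝ} {h : ℕ} (hh : 200 * c ^ 2 < 4 ^ h) (f : (Fin d → ℤ) → ℂ) :
    ∑' x, (⨆ (n : ℕ) (_ : (2 : ℝ) ^ n ≤ c * √d), ‖ballAvg d ((2 : ℝ) ^ n) f x‖ₑ) ^ 2 ≤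
      ENNReal.ofReal (10304 + 32 * h) * ∑' x, ‖f x‖ₑ ^ 2 := by
  obtain ⟨n₀, hn₀⟩ := exists_intermediate_scales d hh
  set I : Finset ℕ := {n ∈ Finset.range (d + 1) | 200 * (2 ^ n) ^ 2 ≤ d} with hI
  set a : ℕ → (Fin d → ℤ) → ℝ≥0∞ := fun n x =>
    ENNReal.ofReal (ballMean (2 ^ n) (fun y => ‖f y‖) x) with ha
  have hpt : ∀ x, (⨆ (n : ℕ) (_ : (2 : ℝ) ^ n ≤ c * √d), ‖ballAvg d ((2 : ℝ) ^ n) f x‖ₑ) ^ 2 ≤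
      (I.sup fun n => a n x) ^ 2 + ∑ n ∈ Finset.Ico n₀ (n₀ + h), a n x ^ 2 := fun x => by
    rw [← ENNReal.rpow_two, ← ENNReal.le_rpow_inv_iff two_pos]
    refine iSup₂_le fun n hn => ?_
    rw [ENNReal.le_rpow_inv_iff two_pos, ENNReal.rpow_two]
    refine (pow_le_pow_left₀ zero_le (enorm_ballAvg_le n f x) 2).trans ?_
    by_cases hd : 200 * (2 ^ n) ^ 2 ≤ d
    · have hmem : n ∈ I := by
        rw [hI, Finset.mem_filter, Finset.mem_range]
        have := Nat.lt_two_pow_self (n := n)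
        exact ⟨by nlinarith, hd⟩
      exact le_add_right (pow_le_pow_left₀ zero_le (Finset.le_sup (f := fun n => a n x) hmem) 2)
    · exact le_add_left (Finset.single_le_sum (f := fun n => a n x ^ 2) (fun _ _ => zero_le)
        (hn₀ n hn (not_le.mp hd)))
  have hgood := tsum_sup_ballMean_sq_le I (A := 1286) (by norm_num)
    (fun n hn m _ hmn z => norm_ballMult_mul_norm_sub_le hmn (Finset.mem_filter.mp hn).2 z) f
  refine (ENNReal.tsum_le_tsum hpt).trans ?_
  rw [ENNReal.tsum_add, Summable.tsum_finsetSum fun _ _ => ENNReal.summable]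
  refine (add_le_add hgood (Finset.sum_le_card_nsmul _ _ _ fun n _ => tsum_ballMean_sq_le n f)).trans
    (le_of_eq ?_)
  rw [Nat.card_Ico, Nat.add_sub_cancel_left, nsmul_eq_mul, ← mul_assoc, ← add_mul,
    ← ENNReal.ofReal_natCast, ← ENNReal.ofReal_mul (Nat.cast_nonneg h),
    ← ENNReal.ofReal_add (by norm_num) (by positivity)]
  congr 2
  ring

end SquareSum

/-- Dimension-free `ℓ₂` bound for the discrete dyadic Hardy–Littlewood
maximal operator with the supremum restricted to dyadic radii
`N = 2^n ≤ c₀ d^{1/2}` (the small-scale case). -/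
theorem dimension_free_small_scale (c₀ : ℝ) (hc₀ : 0 < c₀) :
    ∃ C : ℝ, 0 < C ∧
      ∀ d : ℕ, 1 ≤ d → ∀ f : (Fin d → ℤ) → ℂ,
        lpNorm d 2
            (fun x => ⨆ (n : ℕ) (_ : (2 : ℝ) ^ n ≤ c₀ * Real.sqrt d),
              (‖ballAvg d ((2 : ℝ) ^ n) f x‖₊ : ℝ≥0∞)) ≤
          ENNReal.ofReal C * lpNorm d 2 (fun x => (‖f x‖₊ : ℝ≥0∞)) := by
  obtain ⟨h, hh⟩ := pow_unbounded_of_one_lt (200 * c₀ ^ 2) (by norm_num : (1 : ℝ) < 4)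
  have hpos : (0 : ℝ) < 10304 + 32 * h := by positivity
  refine ⟨(10304 + 32 * h) ^ (1 / 2 : ℝ), by positivity, fun d _ f => ?_⟩
  simp only [_root_.lpNorm, ENNReal.rpow_two]
  rw [← ENNReal.ofReal_rpow_of_pos hpos, ← ENNReal.mul_rpow_of_nonneg _ _ (by norm_num)]
  exact ENNReal.rpow_le_rpow (tsum_iSup_ballAvg_sq_le hh f) (by norm_num)
end
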